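/- arXiv:math/0410275 — 3 statements merged into one kernel-verified Lean document; each statement's English description precedes it below -/
import Mathlib

section
/- Let G be a group equipped with a left-invariant linear order <, and let φ : G → G be an involutive anti-automorphism (φ(x·y) = φ(y)·φ(x) for all x, y, and φ∘φ = id) such that for every x ∈ G, x > 1 if and only if φ(x) > 1. Then the map G → G, x ↦ x·φ(x), is injective. -/
/-- Let `G` be a group with a left-invariant linear order and `φ` an
involutive anti-automorphism such that `x > 1 ↔ φ x > 1`.  Then `x ↦ x * φ x` is injective. -/
theorem palindromization_injective_of_leftOrder {G : Type*} [Group G] (lo : LinearOrder G)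
    (hleft : ∀ a x y : G, lo.lt x y → lo.lt (a * x) (a * y))
    (φ : G → G)
    (hmul : ∀ x y : G, φ (x * y) = φ y * φ x)
    (hinv : ∀ x : G, φ (φ x) = x)
    (hpos : ∀ x : G, lo.lt 1 x ↔ lo.lt 1 (φ x)) :
    Function.Injective fun x : G => x * φ x := by
  replace hleft : ∀ a x y : G, x < y → a * x < a * y := hleft
  replace hpos : ∀ x : G, 1 < x ↔ 1 < φ x := hpos
  intro x y hxy
  replace hxy : x * φ x = y * φ y := hxy
  have hz : φ (y⁻¹ * x) = (y⁻¹ * x)⁻¹ := by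
    apply mul_right_cancel (b := φ y)
    rw [← hmul, mul_inv_cancel_left, mul_inv_rev, inv_inv, mul_assoc, ← hxy, inv_mul_cancel_left]
  have hiff := hpos (y⁻¹ * x)
  rw [hz] at hiff
  generalize hw : y⁻¹ * x = z at hiff
  rcases lt_trichotomy z 1 with h | h | h
  · have h' : 1 < z⁻¹ := by simpa using hleft z⁻¹ z 1 h
    exact absurd (hiff.2 h') h.asymm
  · exact (inv_mul_eq_one.1 (hw.trans h)).symm
  · have h' : z < 1 := by simpa using hleft z 1 z⁻¹ (hiff.1 h)
    exact absurd h' h.asymm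
end

section
/- Let M be a Coxeter matrix of finite type. Then the palindromization map pal : A(M) → A(M), x ↦ x * rev x, is injective, and its image is exactly the set of elements x ∈ A(M) that are both pure (π x = 1) and palindromic (rev x = x). -/
/-- The alternating word `w k (a, b) = a b a b ⋯` (`k` factors) in the free group on `B`. -/
def artinWord {B : Type*} : ℕ → B → B → FreeGroup B
  | 0, _, _ => 1
  | (k + 1), a, b => FreeGroup.of a * artinWord k b a

/-- The Artin relators of a Coxeter matrix `m` : the relators
`w (m i j) (sᵢ, sⱼ) * (w (m i j) (sⱼ, sᵢ))⁻¹` for `i ≠ j` with `m i j ≠ 0`. -/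
def artinRels {B : Type*} (m : B → B → ℕ) : Set (FreeGroup B) :=
  { r | ∃ i j : B, i ≠ j ∧ m i j ≠ 0 ∧
      r = artinWord (m i j) i j * (artinWord (m i j) j i)⁻¹ }

/-- The Artin group of a Coxeter matrix `m`, as a presented group. -/
def ArtinGroup {B : Type*} (m : B → B → ℕ) : Type _ := PresentedGroup (artinRels m)

instance {B : Type*} (m : B → B → ℕ) : Group (ArtinGroup m) :=
  QuotientGroup.Quotient.group _

/-- The Artin generator `s i` of the Artin group. -/
def artinGen {B : Type*} (m : B → B → ℕ) (i : B) : ArtinGroup m := PresentedGroup.of i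

namespace CoxeterMatrix

open Polynomial.Chebyshev

variable {B : Type*} (M : CoxeterMatrix B)

/-- The linear form `2 ⟨e i, ·⟩` of the geometric representation. -/
noncomputable def geomForm (i : B) : Module.Dual ℝ (B →₀ ℝ) :=
  Finsupp.lsum ℝ fun j => (-2 * Real.cos (Real.pi / M i j)) • LinearMap.id

theorem geomForm_single (i j : B) :
    M.geomForm i (Finsupp.single j 1) = -2 * Real.cos (Real.pi / M i j) := by
  simp [geomForm]

theorem geomForm_single_self (i : B) : M.geomForm i (Finsupp.single i 1) = 2 := by
  simp [geomForm_single]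

/-- The reflections of the geometric representation. -/
noncomputable def geomReflection (i : B) : (B →₀ ℝ) ≃ₗ[ℝ] (B →₀ ℝ) :=
  Module.reflection (M.geomForm_single_self i)

theorem geomForm_mul_sub_two (i j : B) :
    M.geomForm i (Finsupp.single j 1) * M.geomForm j (Finsupp.single i 1) - 2 =
      2 * Real.cos (2 * Real.pi / M i j) := by
  rw [geomForm_single, geomForm_single, M.symmetric j i, mul_div_assoc, Real.cos_two_mul]
  ring

theorem geomReflection_isLiftable : M.IsLiftable M.geomReflection := by
  intro i j
  by_cases hij : i = j
  · subst hij
    rw [M.diagonal, pow_one, geomReflection]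
    ext1 x
    exact Module.involutive_reflection (M.geomForm_single_self i) x
  rcases Nat.eq_zero_or_pos (M i j) with h0 | hpos
  · rw [h0, pow_zero]
  have h1 := M.off_diagonal i j hij
  apply LinearEquiv.toLinearMap_injective
  rw [geomReflection, geomReflection,
    Module.reflection_mul_reflection_pow _ _ _ _ (M.geomForm_mul_sub_two i j).symm]
  have hform : M.geomForm j (Finsupp.single i 1) = -2 * Real.cos (Real.pi / M i j) := by
    rw [geomForm_single, M.symmetric j i]
  have hform' := M.geomForm_single i j
  rw [hform, hform']
  generalize hm : M i j = m at *
  have hmR : (m : ℝ) ≠ 0 := by positivity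
  have hS := fun n : ℤ => S_two_mul_real_cos (2 * Real.pi / m) n
  by_cases h2 : m = 2
  · subst h2
    ext x : 1
    simp [S_one]
    refine LinearMap.ext fun c => ?_
    simp
    module
  have hsin : Real.sin (2 * Real.pi / m) ≠ 0 := by
    apply ne_of_gt
    have : (3 : ℝ) ≤ m := by exact_mod_cast (by omega : 3 ≤ m)
    apply Real.sin_pos_of_pos_of_lt_pi
    · positivity
    · rw [div_lt_iff₀ (by positivity)]
      nlinarith [Real.pi_pos]
  obtain ⟨p, rfl | rfl⟩ := m.even_or_odd'
  · have e1 : (((2 * p : ℕ) : ℤ) - 2) / 2 = p - 1 := by omega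
    have e2 : (((2 * p : ℕ) : ℤ) - 1) / 2 = p - 1 := by omega
    have hz : (S ℝ ((p : ℤ) - 1)).eval (2 * Real.cos (2 * Real.pi / (2 * p : ℕ))) = 0 := by
      have := hS (p - 1)
      rw [show (((p : ℤ) - 1 : ℤ) + 1 : ℝ) * (2 * Real.pi / (2 * p : ℕ)) = Real.pi by
        have hp : (p : ℝ) ≠ 0 := by rintro h; simp [h] at hmR
        push_cast; field_simp; ring, Real.sin_pi] at this
      exact (mul_eq_zero.1 this).resolve_right hsin
    rw [e1, e2, hz]
    simp
  · have e1 : (((2 * p + 1 : ℕ) : ℤ) - 2) / 2 = p - 1 := by omega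
    have e2 : (((2 * p + 1 : ℕ) : ℤ) - 1) / 2 = p := by omega
    have e3 : (((2 * p + 1 : ℕ) : ℤ) - 3) / 2 = p - 1 := by omega
    have e4 : (((2 * p + 1 : ℕ) : ℤ)) / 2 = p := by omega
    have hz : (S ℝ (p : ℤ)).eval (2 * Real.cos (2 * Real.pi / (2 * p + 1 : ℕ))) +
        (S ℝ ((p : ℤ) - 1)).eval (2 * Real.cos (2 * Real.pi / (2 * p + 1 : ℕ))) = 0 := by
      have h1 := hS (p - 1)
      have h2 := hS p
      rw [show (((p : ℤ) : ℝ) + 1) * (2 * Real.pi / (2 * p + 1 : ℕ)) =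
        2 * Real.pi - (((p : ℤ) - 1 : ℤ) + 1 : ℝ) * (2 * Real.pi / (2 * p + 1 : ℕ)) by
        push_cast at hmR ⊢; field_simp; ring, Real.sin_two_pi_sub] at h2
      have : ((S ℝ (p : ℤ)).eval (2 * Real.cos (2 * Real.pi / (2 * p + 1 : ℕ))) +
        (S ℝ ((p : ℤ) - 1)).eval (2 * Real.cos (2 * Real.pi / (2 * p + 1 : ℕ)))) *
          Real.sin (2 * Real.pi / (2 * p + 1 : ℕ)) = 0 := by
        rw [add_mul, h1, h2]; ring
      exact (mul_eq_zero.1 this).resolve_right hsin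
    rw [e1, e2, e3, e4, hz]
    simp

end CoxeterMatrix

namespace CoxeterSystem

open Polynomial.Chebyshev

variable {B W : Type*} [Group W] {M : CoxeterMatrix B} (cs : CoxeterSystem M W)

theorem simple_mul_simple_pow_ne_one {i j : B} (hij : i ≠ j) {k : ℕ} (hk : k ≠ 0)
    (hlt : M i j ≠ 0 → k < M i j) : (cs.simple i * cs.simple j) ^ k ≠ 1 := by
  intro h
  have h' := congrArg (cs.lift ⟨M.geomReflection, M.geomReflection_isLiftable⟩) h
  rw [map_pow, map_mul, lift_apply_simple, lift_apply_simple, map_one] at h'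
  have h'' := LinearEquiv.congr_fun h' (Finsupp.single i 1)
  rw [CoxeterMatrix.geomReflection, CoxeterMatrix.geomReflection,
    Module.reflection_mul_reflection_pow_apply_self _ _ _ _
      (M.geomForm_mul_sub_two i j).symm] at h''
  have hi := DFunLike.congr_fun h'' i
  have hj := DFunLike.congr_fun h'' j
  simp [hij, hij.symm, CoxeterMatrix.geomForm_single, M.symmetric j i] at hi hj
  have h1 := M.off_diagonal i j hij
  generalize M i j = m at *
  have hS := fun n : ℤ => S_two_mul_real_cos (2 * Real.pi / m) n
  rcases Nat.eq_zero_or_pos m with rfl | hpos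
  · simp at hj
    exact hk hj
  have hmR : (0 : ℝ) < m := by positivity
  by_cases h2 : m = 2
  · subst h2
    obtain rfl : k = 1 := by have := hlt (by norm_num); omega
    simp at hi
  have hsin : Real.sin (2 * Real.pi / m) ≠ 0 := by
    apply ne_of_gt
    have : (3 : ℝ) ≤ m := by exact_mod_cast (by omega : 3 ≤ m)
    apply Real.sin_pos_of_pos_of_lt_pi
    · positivity
    · rw [div_lt_iff₀ (by positivity)]
      nlinarith [Real.pi_pos]
  have hcos : Real.cos (Real.pi / m) ≠ 0 := by
    intro h0
    apply hsin
    rw [mul_div_assoc, Real.sin_two_mul, h0, mul_zero]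
  replace hj := hj.resolve_right hcos
  rw [hj, add_zero] at hi
  have h3 := hS k
  have h4 := hS (k - 1)
  rw [hi, one_mul] at h3
  rw [hj, zero_mul] at h4
  push_cast at h3 h4
  rw [add_mul, one_mul, Real.sin_add] at h3
  rw [sub_add_cancel] at h4
  rw [← h4, zero_mul, zero_add] at h3
  have hc : Real.cos (k * (2 * Real.pi / m)) = 1 :=
    mul_right_cancel₀ hsin (by rw [one_mul, ← h3])
  have hkm : (k : ℝ) < m := by exact_mod_cast hlt hpos.ne'
  have hk0 : (0 : ℝ) < k := by positivity
  have hlow : 0 < k * (2 * Real.pi / m) := by positivity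
  have hhigh : k * (2 * Real.pi / m) < 2 * Real.pi := by
    rw [mul_div_assoc', div_lt_iff₀ hmR, mul_comm]
    exact mul_lt_mul_of_pos_left hkm (by positivity)
  exact hlow.ne' ((Real.cos_eq_one_iff_of_lt_of_lt (by linarith) hhigh).1 hc)

end CoxeterSystem

namespace CoxeterSystem

open List

variable {B W : Type*} [Group W] {M : CoxeterMatrix B} (cs : CoxeterSystem M W)

local prefix:100 "s" => cs.simple
local prefix:100 "π" => cs.wordProd
local prefix:100 "ℓ" => cs.length
local prefix:100 "lis" => cs.leftInvSeq

open Classical in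
/-- The map `(t, e) ↦ (sᵢ t sᵢ, e + [t = sᵢ])`, which records in its second component
the parity of the number of occurrences of `t` in a left inversion sequence. -/
noncomputable def signedConj (i : B) : Function.End (W × ZMod 2) :=
  fun p => (s i * p.1 * s i, p.2 + if p.1 = s i then 1 else 0)

open Classical in
theorem prod_reverse_map_signedConj (ω : List B) (t : W) (e : ZMod 2) :
    (ω.map cs.signedConj).reverse.prod (t, e) =
      ((π ω)⁻¹ * t * π ω, e + ((lis ω).count t : ℕ)) := by
  induction ω generalizing t e with
  | nil => simp; rfl
  | cons i ω ih =>
    have hcount : ((lis ω).map (MulAut.conj (s i))).count t = (lis ω).count (s i * t * s i) := by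
      have := List.count_map_of_injective (lis ω) (MulAut.conj (s i)) (MulEquiv.injective _)
        (s i * t * s i)
      rw [← this]
      simp [mul_assoc]
    rw [List.map_cons, List.reverse_cons, List.prod_append, List.prod_singleton]
    change (ω.map cs.signedConj).reverse.prod (cs.signedConj i (t, e)) = _
    rw [signedConj, ih, leftInvSeq, List.count_cons, hcount, wordProd_cons]
    ext
    · simp [mul_assoc]
    · simp only [beq_iff_eq, eq_comm (a := s i)]
      push_cast
      ring

theorem even_count_leftInvSeq_alternatingWord [DecidableEq W] (i j : B) (t : W) :
    Even ((lis (alternatingWord i j (2 * M i j))).count t) := by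
  have hsplit : (lis (alternatingWord i j (2 * M i j))).drop (M i j) =
      (lis (alternatingWord i j (2 * M i j))).take (M i j) := by
    apply List.ext_getElem
    · simp; omega
    · intro k hk hk'
      have hk : k < M i j := by simp at hk; omega
      rw [List.getElem_drop, List.getElem_take,
        getElem_leftInvSeq_alternatingWord _ _ _ _ _ (by omega),
        getElem_leftInvSeq_alternatingWord _ _ _ _ _ (by omega), prod_alternatingWord_eq_mul_pow,
        prod_alternatingWord_eq_mul_pow]
      have h1 : ¬ Even (2 * (M i j + k) + 1) := by simp [parity_simps]
      have h2 : ¬ Even (2 * k + 1) := by simp [parity_simps]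
      rw [if_neg h1, if_neg h2, show (2 * (M i j + k) + 1) / 2 = M i j + k by omega,
        show (2 * k + 1) / 2 = k by omega, pow_add, simple_mul_simple_pow', one_mul]
  rw [← List.take_append_drop (M i j) (lis (alternatingWord i j (2 * M i j))), hsplit,
    List.count_append]
  exact ⟨_, rfl⟩

theorem signedConj_isLiftable : M.IsLiftable cs.signedConj := by
  classical
  have key (i j : B) (m : ℕ) : (cs.signedConj i * cs.signedConj j) ^ m =
      ((alternatingWord j i (2 * m)).map cs.signedConj).reverse.prod := by
    induction m with
    | zero => simp [alternatingWord]
    | succ m ih =>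
      rw [pow_succ', ih, Nat.mul_succ, alternatingWord_succ, alternatingWord_succ]
      simp [mul_assoc]
  intro i j
  rw [key]
  funext ⟨t, e⟩
  rw [prod_reverse_map_signedConj, M.symmetric i j,
    (ZMod.natCast_eq_zero_iff_even).2 (cs.even_count_leftInvSeq_alternatingWord j i t),
    prod_alternatingWord_eq_mul_pow]
  simp
  rfl

theorem simple_mem_leftInvSeq {ω : List B} {i : B} (h : cs.IsLeftDescent (π ω) i) :
    s i ∈ lis ω := by
  classical
  obtain ⟨ω', hω', hw⟩ := cs.exists_isReduced (s i * π ω)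
  have hprod : π (i :: ω') = π ω := by rw [wordProd_cons, ← hw, simple_mul_simple_cancel_left]
  have hred : cs.IsReduced (i :: ω') := by
    rw [IsReduced, hprod, List.length_cons, ← hω'.eq, ← hw]
    exact (cs.isLeftDescent_iff.1 h).symm
  have hact (τ : List B) : cs.lift ⟨_, cs.signedConj_isLiftable⟩ (π τ)⁻¹ =
      (τ.map cs.signedConj).reverse.prod := by
    rw [← wordProd_reverse, wordProd, map_list_prod, List.map_map, ← List.map_reverse]
    congr 1
    exact List.map_congr_left fun i _ => lift_apply_simple _ _ i
  have hpar : ((lis (i :: ω')).count (s i) : ZMod 2) = (lis ω).count (s i) := by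
    have h1 := congrFun (hact (i :: ω')) (s i, 0)
    rw [hprod, hact, prod_reverse_map_signedConj, prod_reverse_map_signedConj] at h1
    simpa using (congrArg Prod.snd h1).symm
  have hone : (lis (i :: ω')).count (s i) = 1 :=
    List.count_eq_one_of_mem hred.nodup_leftInvSeq (by simp [leftInvSeq])
  rw [hone] at hpar
  by_contra hmem
  rw [List.count_eq_zero_of_not_mem hmem] at hpar
  simp at hpar

/-- The exchange property. -/
theorem exists_sublist_of_isLeftDescent {ω : List B} {i : B} (h : cs.IsLeftDescent (π ω) i) :
    ∃ ρ : List B, ρ.Sublist ω ∧ ρ.length + 1 = ω.length ∧ s i * π ω = π ρ := by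
  obtain ⟨j, hj, hji⟩ := List.mem_iff_getElem.1 (cs.simple_mem_leftInvSeq h)
  refine ⟨ω.eraseIdx j, List.eraseIdx_sublist _ _, ?_, ?_⟩
  · exact List.length_eraseIdx_add_one (by simpa using hj)
  · rw [← getD_leftInvSeq_mul_wordProd, List.getD_eq_getElem _ 1 hj, hji]

theorem not_isReduced_cons {ω : List B} {i : B} (hω : cs.IsReduced ω) :
    ¬ cs.IsReduced (i :: ω) ↔ cs.IsLeftDescent (π ω) i := by
  have h1 := hω.eq
  rw [IsReduced, wordProd_cons, IsLeftDescent, List.length_cons]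
  rcases cs.length_simple_mul (π ω) i with h | h <;> omega

/-- The deletion property. -/
theorem exists_sublist_of_not_isReduced {ω : List B} (h : ¬ cs.IsReduced ω) :
    ∃ ρ : List B, ρ.Sublist ω ∧ ρ.length < ω.length ∧ π ω = π ρ := by
  induction ω with
  | nil => exact absurd (by simp [IsReduced]) h
  | cons i ω ih =>
    by_cases hω : cs.IsReduced ω
    · obtain ⟨ρ, hρ, hlen, hprod⟩ :=
        cs.exists_sublist_of_isLeftDescent ((cs.not_isReduced_cons hω).1 h)
      exact ⟨ρ, hρ.cons i, by simp; omega, by rw [wordProd_cons, hprod]⟩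
    · obtain ⟨ρ, hρ, hlen, hprod⟩ := ih hω
      exact ⟨i :: ρ, hρ.cons_cons i, by simpa using hlen, by
        rw [wordProd_cons, hprod, wordProd_cons]⟩

theorem isReduced_of_nodup_leftInvSeq {ω : List B} (h : (lis ω).Nodup) : cs.IsReduced ω := by
  induction ω with
  | nil => simp [IsReduced]
  | cons i ω ih =>
    rw [leftInvSeq, List.nodup_cons] at h
    have hω := ih (List.Nodup.of_map _ h.2)
    by_contra hred
    refine h.1 (List.mem_map.2
      ⟨s i, cs.simple_mem_leftInvSeq ((cs.not_isReduced_cons hω).1 hred), ?_⟩)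
    simp

theorem isReduced_alternatingWord {i j : B} (hij : i ≠ j) {k : ℕ}
    (hk : M i j ≠ 0 → k ≤ M i j) : cs.IsReduced (alternatingWord i j k) := by
  have key {i j : B} (hij : i ≠ j) (hk : M i j ≠ 0 → k ≤ M i j) :
      cs.IsReduced ((alternatingWord i j (2 * (k + 1))).take k) := by
    apply isReduced_of_nodup_leftInvSeq
    rw [leftInvSeq_take, List.nodup_iff_pairwise_ne, List.pairwise_iff_getElem]
    intro a b ha hb hab heq
    simp at ha hb
    rw [List.getElem_take, List.getElem_take,
      getElem_leftInvSeq_alternatingWord _ _ _ _ _ (by omega),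
      getElem_leftInvSeq_alternatingWord _ _ _ _ _ (by omega), prod_alternatingWord_eq_mul_pow,
      prod_alternatingWord_eq_mul_pow] at heq
    have h1 : ¬ Even (2 * a + 1) := by simp [parity_simps]
    have h2 : ¬ Even (2 * b + 1) := by simp [parity_simps]
    rw [if_neg h1, if_neg h2, show (2 * a + 1) / 2 = a by omega, show (2 * b + 1) / 2 = b by omega,
      mul_right_inj, show b = a + (b - a) by omega, pow_add, left_eq_mul] at heq
    refine cs.simple_mul_simple_pow_ne_one hij.symm (by omega) (fun h => ?_) heq
    rw [M.symmetric] at h ⊢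
    have := hk h
    omega
  have h1 := key hij hk
  have h2 := key hij.symm (by rwa [M.symmetric])
  rw [listTake_alternatingWord _ _ _ _ (by omega)] at h1 h2
  split_ifs at h1 h2 <;> assumption

theorem coxeterMatrix_ne_zero (cs : CoxeterSystem M W) [Finite W] (i j : B) : M i j ≠ 0 := by
  intro h0
  have hij : i ≠ j := by
    rintro rfl
    simp at h0
  have hred (k : ℕ) : cs.length (cs.wordProd (alternatingWord i j k)) = k := by
    rw [(cs.isReduced_alternatingWord hij fun h => absurd h0 h).eq, length_alternatingWord]
  exact not_injective_infinite_finite (fun k : ℕ => cs.wordProd (alternatingWord i j k))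
    fun k l hkl => by simpa [hred] using congrArg cs.length hkl

theorem exists_eq_alternatingWord {i j : B} {τ : List B} (hτ : cs.IsReduced τ)
    (hmem : ∀ z ∈ τ, z = i ∨ z = j) :
    τ = alternatingWord i j τ.length ∨ τ = alternatingWord j i τ.length := by
  induction τ with
  | nil => simp [alternatingWord]
  | cons z τ ih =>
    have hred : cs.IsReduced τ := by simpa using hτ.drop 1
    have hne : ∀ y ρ, τ = y :: ρ → z ≠ y := by
      rintro y ρ rfl rfl
      have h1 := hτ.eq
      rw [wordProd_cons, wordProd_cons, simple_mul_simple_cancel_left] at h1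
      have h2 := cs.length_wordProd_le ρ
      simp at h1
      omega
    have hz := hmem z (by simp)
    cases τ with
    | nil => rcases hz with rfl | rfl <;> simp [alternatingWord]
    | cons y ρ =>
      have hy := hmem y (by simp)
      have hzy := hne y ρ rfl
      rw [List.length_cons, alternatingWord_succ' i, alternatingWord_succ' j]
      rcases ih hred fun x hx => hmem x (by simp [hx]) with h | h
      · left
        rw [← h]
        congr 1
        rw [List.length_cons, alternatingWord_succ', List.cons.injEq] at h
        simp only [List.length_cons, Nat.even_add_one]
        have := h.1
        grind
      · right
        rw [← h]
        congr 1
        rw [List.length_cons, alternatingWord_succ', List.cons.injEq] at h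
        simp only [List.length_cons, Nat.even_add_one]
        have := h.1
        grind

end CoxeterSystem

namespace CoxeterSystem

open List

variable {B W : Type*} [Group W] {M : CoxeterMatrix B} (cs : CoxeterSystem M W)

local prefix:100 "s" => cs.simple
local prefix:100 "π" => cs.wordProd
local prefix:100 "ℓ" => cs.length

/-- The left-prefix (right weak) order on a Coxeter group. -/
def IsPrefix (x y : W) : Prop := ℓ x + ℓ (x⁻¹ * y) = ℓ y

theorem isPrefix_refl (x : W) : cs.IsPrefix x x := by simp [IsPrefix]

theorem one_isPrefix (x : W) : cs.IsPrefix 1 x := by simp [IsPrefix]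

theorem isPrefix_mul_iff {x y : W} : cs.IsPrefix x (x * y) ↔ ℓ x + ℓ y = ℓ (x * y) := by
  simp [IsPrefix]

theorem simple_isPrefix_iff {i : B} {w : W} : cs.IsPrefix (s i) w ↔ cs.IsLeftDescent w i := by
  rw [IsPrefix, isLeftDescent_iff, inv_simple, length_simple, add_comm]

variable {cs}

theorem IsPrefix.length_le {x y : W} (h : cs.IsPrefix x y) : ℓ x ≤ ℓ y := by
  unfold IsPrefix at h
  omega

theorem IsPrefix.trans {x y z : W} (hxy : cs.IsPrefix x y) (hyz : cs.IsPrefix y z) :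
    cs.IsPrefix x z := by
  unfold IsPrefix at *
  have h1 := cs.length_mul_le (x⁻¹ * y) (y⁻¹ * z)
  have h2 := cs.length_mul_le x (x⁻¹ * z)
  simp only [mul_assoc, mul_inv_cancel_left] at h1 h2
  omega

theorem IsPrefix.eq_of_length_le {x y : W} (h : cs.IsPrefix x y) (hl : ℓ y ≤ ℓ x) : x = y := by
  unfold IsPrefix at h
  have h1 : ℓ (x⁻¹ * y) = 0 := by omega
  rw [length_eq_zero_iff] at h1
  exact inv_mul_eq_one.1 h1

theorem IsPrefix.antisymm {x y : W} (hxy : cs.IsPrefix x y) (hyx : cs.IsPrefix y x) : x = y :=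
  hxy.eq_of_length_le hyx.length_le

theorem IsPrefix.eq_one {x : W} (h : cs.IsPrefix x 1) : x = 1 :=
  h.antisymm (cs.one_isPrefix x)

theorem IsPrefix.left_of_mul {v z y : W} (hz : ℓ (v * z) = ℓ v + ℓ z)
    (h : cs.IsPrefix (v * z) y) : cs.IsPrefix v y :=
  IsPrefix.trans (cs.isPrefix_mul_iff.2 hz.symm) h

theorem isPrefix_mul_left_iff {v z y : W} (hz : ℓ (v * z) = ℓ v + ℓ z)
    (hy : ℓ (v * y) = ℓ v + ℓ y) : cs.IsPrefix (v * z) (v * y) ↔ cs.IsPrefix z y := by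
  unfold IsPrefix
  rw [show (v * z)⁻¹ * (v * y) = z⁻¹ * y by group]
  omega

variable (cs)

theorem isPrefix_wordProd_braidWord {i j : B} (hij : i ≠ j) (hM : M i j ≠ 0) {w : W}
    (hi : cs.IsLeftDescent w i) (hj : cs.IsLeftDescent w j) :
    cs.IsPrefix (π (braidWord M i j)) w := by
  let S : Set (List B × List B) := {p | (∀ z ∈ p.1, z = i ∨ z = j) ∧ w = π (p.1 ++ p.2)}
  obtain ⟨ω, -, hω⟩ := cs.exists_isReduced w
  obtain ⟨⟨τ, ω'⟩, ⟨hmem, hw⟩, hmin⟩ := (InvImage.wf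
    (fun p : List B × List B => toLex (p.2.length, p.1.length)) wellFounded_lt).has_min S
    ⟨([], ω), by simp, by simpa using hω⟩
  simp only [InvImage, Prod.Lex.toLex_lt_toLex, not_or, not_and, not_lt] at hmin
  simp only at hmem hw
  have hred : cs.IsReduced (τ ++ ω') := by
    by_contra h
    obtain ⟨ρ, hρ, hlen, hprod⟩ := cs.exists_sublist_of_not_isReduced h
    obtain ⟨ρ₁, ρ₂, rfl, h1, h2⟩ := List.sublist_append_iff.1 hρ
    obtain ⟨h3, h6⟩ := hmin (ρ₁, ρ₂) ⟨fun z hz => hmem z (h1.subset hz), hw.trans hprod⟩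
    have h4 := h1.length_le
    have h5 := h2.length_le
    simp only [List.length_append] at h3 h6 hlen
    omega
  have hτ : cs.IsReduced τ := by simpa using hred.take τ.length
  obtain ⟨a, b, hab, hτab, hMab, hbraid, hbmem⟩ : ∃ a b, a ≠ b ∧
      τ = alternatingWord a b τ.length ∧ M a b = M i j ∧
      π (braidWord M i j) = π (braidWord M a b) ∧ ∀ z, z = a ∨ z = b → z = i ∨ z = j := by
    rcases cs.exists_eq_alternatingWord hτ hmem with h | h
    · exact ⟨i, j, hij, h, rfl, rfl, fun z => id⟩
    · exact ⟨j, i, hij.symm, h, M.symmetric j i, cs.wordProd_braidWord_eq i j, fun z => Or.symm⟩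
  have hk : τ.length ≤ M a b := by
    by_contra! h
    exact cs.not_isReduced_alternatingWord a b (by omega) h (hτab ▸ hτ)
  rcases hk.lt_or_eq with hk | hk
  · exfalso
    set z := if Even τ.length then b else a with hz
    have hzij : z = i ∨ z = j := hbmem z (by grind)
    have hzτ : cs.IsReduced (z :: τ) := by
      rw [hτab, hz, ← alternatingWord_succ']
      exact cs.isReduced_alternatingWord hab fun _ => hk
    have hzw : cs.IsLeftDescent (π (τ ++ ω')) z := by
      rw [← hw]
      rcases hzij with h | h <;> rwa [h]
    obtain ⟨ρ, hρ, hlen, hprod⟩ := cs.exists_sublist_of_isLeftDescent hzw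
    obtain ⟨ρ₁, ρ₂, rfl, h1, h2⟩ := List.sublist_append_iff.1 hρ
    have h3 := hmin (z :: ρ₁, ρ₂) ⟨?_, ?_⟩
    · have h4 : ρ₂ = ω' := h2.eq_of_length_le h3.1
      subst h4
      rw [wordProd_append, wordProd_append, ← mul_assoc, mul_left_inj, ← wordProd_cons] at hprod
      have h5 := hzτ.eq
      rw [hprod] at h5
      have h6 := cs.length_wordProd_le ρ₁
      have h7 := h1.length_le
      simp at h5
      omega
    · intro y hy
      rcases List.mem_cons.1 hy with rfl | hy
      · exact hzij
      · exact hmem y (h1.subset hy)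
    · rw [List.cons_append, wordProd_cons, ← hprod, ← hw, simple_mul_simple_cancel_left]
  · have hd : π (braidWord M i j) = π τ := by rw [hbraid, braidWord, ← hk, ← hτab]
    rw [hd, hw, wordProd_append, isPrefix_mul_iff, ← wordProd_append, hred.eq, hτ.eq,
      List.length_append]
    have h1 : cs.IsReduced ω' := by simpa using hred.drop τ.length
    rw [h1.eq]

end CoxeterSystem

namespace CoxeterSystem

open List

variable {B W : Type*} [Group W] {M : CoxeterMatrix B} {cs : CoxeterSystem M W}

local prefix:100 "s" => cs.simple
local prefix:100 "π" => cs.wordProd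
local prefix:100 "ℓ" => cs.length

theorem IsPrefix.length_mul {v z y : W} (h : cs.IsPrefix z y) (hy : ℓ (v * y) = ℓ v + ℓ y) :
    ℓ (v * z) = ℓ v + ℓ z := by
  unfold IsPrefix at h
  have h1 := cs.length_mul_le (v * z) (z⁻¹ * y)
  have h2 := cs.length_mul_le v z
  rw [show v * z * (z⁻¹ * y) = v * y by group] at h1
  omega

variable (cs)

theorem isLeftDescent_of_isReduced_cons {i : B} {ω : List B} (h : cs.IsReduced (i :: ω)) :
    cs.IsLeftDescent (π (i :: ω)) i := by
  have h1 := h.eq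
  have h2 := cs.length_wordProd_le ω
  rw [IsLeftDescent, h1, wordProd_cons, simple_mul_simple_cancel_left, List.length_cons]
  omega

theorem simple_isPrefix_wordProd_braidWord {i j : B} (hij : i ≠ j) (hM : M i j ≠ 0) :
    cs.IsPrefix (s i) (π (braidWord M i j)) ∧ cs.IsPrefix (s j) (π (braidWord M i j)) := by
  have key (i j : B) (hij : i ≠ j) (hM : M i j ≠ 0) :
      cs.IsPrefix (s if Even (M i j) then i else j) (π (braidWord M i j)) := by
    obtain ⟨k, hk⟩ := Nat.exists_eq_succ_of_ne_zero hM
    have hred := cs.isReduced_alternatingWord hij fun _ => le_rfl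
    rw [simple_isPrefix_iff, braidWord]
    rw [hk, alternatingWord_succ'] at hred ⊢
    simp only [Nat.even_add_one, ite_not, Nat.succ_eq_add_one]
    exact cs.isLeftDescent_of_isReduced_cons hred
  have h1 := key i j hij hM
  have h2 := key j i hij.symm (by rwa [M.symmetric])
  rw [M.symmetric j i, ← wordProd_braidWord_eq] at h2
  split_ifs at h1 h2 with h <;> exact ⟨by assumption, by assumption⟩

theorem exists_simple_isPrefix {w : W} (hw : w ≠ 1) : ∃ i, cs.IsPrefix (s i) w := by
  simpa only [simple_isPrefix_iff] using cs.exists_leftDescent_of_ne_one hw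

theorem isPrefix_iff_simple_mul_isPrefix {i : B} {z y : W} (hz : cs.IsPrefix (s i) z)
    (hy : cs.IsPrefix (s i) y) : cs.IsPrefix z y ↔ cs.IsPrefix (s i * z) (s i * y) := by
  have h1 := cs.isPrefix_mul_left_iff (v := s i) (z := s i * z) (y := s i * y)
  unfold IsPrefix at hz hy
  rw [inv_simple] at hz hy
  simp only [simple_mul_simple_cancel_left] at h1
  exact h1 hz.symm hy.symm

theorem exists_meet [Finite W] (x y : W) :
    ∃ m, ∀ z, cs.IsPrefix z m ↔ cs.IsPrefix z x ∧ cs.IsPrefix z y := by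
  induction hn : ℓ x generalizing x y with
  | zero =>
    rw [length_eq_zero_iff] at hn
    exact ⟨1, fun z => ⟨fun h => h.eq_one ▸ ⟨cs.one_isPrefix _, cs.one_isPrefix _⟩,
      fun h => hn ▸ h.1⟩⟩
  | succ n ih =>
    have step (i : B) (hx : cs.IsPrefix (s i) x) (hy : cs.IsPrefix (s i) y) :
        ∃ m, cs.IsPrefix (s i) m ∧ ∀ z, cs.IsPrefix (s i) z →
          (cs.IsPrefix z m ↔ cs.IsPrefix z x ∧ cs.IsPrefix z y) := by
      have hlx : ℓ (s i * x) = n := by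
        have h1 := cs.isLeftDescent_iff.1 (cs.simple_isPrefix_iff.1 hx)
        omega
      obtain ⟨m, hm⟩ := ih (s i * x) (s i * y) hlx
      have hadd : ℓ (s i * (s i * x)) = ℓ (s i) + ℓ (s i * x) := by
        rw [simple_mul_simple_cancel_left, hlx, length_simple]
        omega
      have hsm : cs.IsPrefix (s i) (s i * m) := by
        rw [isPrefix_mul_iff]
        exact (((hm m).1 (cs.isPrefix_refl m)).1.length_mul hadd).symm
      refine ⟨s i * m, hsm, fun z hz => ?_⟩
      rw [cs.isPrefix_iff_simple_mul_isPrefix hz hx, cs.isPrefix_iff_simple_mul_isPrefix hz hy,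
        cs.isPrefix_iff_simple_mul_isPrefix hz hsm, simple_mul_simple_cancel_left, hm]
    by_cases h : ∃ i, cs.IsPrefix (s i) x ∧ cs.IsPrefix (s i) y
    · obtain ⟨i, hix, hiy⟩ := h
      obtain ⟨m, him, hm⟩ := step i hix hiy
      obtain ⟨hmx, hmy⟩ := (hm m him).1 (cs.isPrefix_refl m)
      refine ⟨m, fun z => ⟨fun hz => ⟨hz.trans hmx, hz.trans hmy⟩, fun ⟨hzx, hzy⟩ => ?_⟩⟩
      by_cases hz1 : z = 1
      · exact hz1 ▸ cs.one_isPrefix m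
      obtain ⟨j, hj⟩ := cs.exists_simple_isPrefix hz1
      by_cases hij : i = j
      · exact (hm z (hij ▸ hj)).2 ⟨hzx, hzy⟩
      obtain ⟨m', hjm', hm'⟩ := step j (hj.trans hzx) (hj.trans hzy)
      obtain ⟨hmx', hmy'⟩ := (hm' m' hjm').1 (cs.isPrefix_refl m')
      have hMij := cs.coxeterMatrix_ne_zero i j
      obtain ⟨hid, hjd⟩ := cs.simple_isPrefix_wordProd_braidWord hij hMij
      have hdx := cs.isPrefix_wordProd_braidWord hij hMij (cs.simple_isPrefix_iff.1 hix)
        (cs.simple_isPrefix_iff.1 (hj.trans hzx))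
      have hdy := cs.isPrefix_wordProd_braidWord hij hMij (cs.simple_isPrefix_iff.1 hiy)
        (cs.simple_isPrefix_iff.1 (hj.trans hzy))
      have him' := hid.trans ((hm' _ hjd).2 ⟨hdx, hdy⟩)
      exact ((hm' z hj).2 ⟨hzx, hzy⟩).trans ((hm m' him').2 ⟨hmx', hmy'⟩)
    · refine ⟨1, fun z => ⟨fun hz => hz.eq_one ▸ ⟨cs.one_isPrefix _, cs.one_isPrefix _⟩,
        fun hz => ?_⟩⟩
      by_cases hz1 : z = 1
      · exact hz1 ▸ cs.one_isPrefix 1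
      · obtain ⟨i, hi⟩ := cs.exists_simple_isPrefix hz1
        exact absurd ⟨i, hi.trans hz.1, hi.trans hz.2⟩ h

theorem exists_longest [Finite W] : ∃ w₀, ∀ x, cs.IsPrefix x w₀ := by
  obtain ⟨w₀, hw₀⟩ := Finite.exists_max cs.length
  refine ⟨w₀, fun x => ?_⟩
  obtain ⟨ω, hω, rfl⟩ := cs.exists_isReduced x
  induction ω with
  | nil => simpa using cs.one_isPrefix w₀
  | cons i ω ih =>
    have hω' : cs.IsReduced ω := by simpa using hω.drop 1
    have h := ih hω'
    obtain ⟨ρ, hρ, hc⟩ := cs.exists_isReduced ((π ω)⁻¹ * w₀)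
    have hw : w₀ = π (ω ++ ρ) := by rw [wordProd_append, ← hc, mul_inv_cancel_left]
    have hi : cs.IsLeftDescent (π (ω ++ ρ)) i := by
      rw [← hw, IsLeftDescent]
      exact lt_of_le_of_ne (hw₀ _) (cs.length_simple_mul_ne w₀ i)
    have hlen : ℓ w₀ = ω.length + ρ.length := by
      rw [← h, hω'.eq, hc, hρ.eq]
    obtain ⟨σ, hσ, hσlen, hprod⟩ := cs.exists_sublist_of_isLeftDescent hi
    obtain ⟨σ₁, σ₂, rfl, h1, h2⟩ := List.sublist_append_iff.1 hσ
    have h3 := h1.length_le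
    have h4 := h2.length_le
    simp only [List.length_append] at hσlen
    by_cases h5 : σ₁.length = ω.length
    · obtain rfl := h1.eq_of_length h5
      have h6 : w₀ = π (i :: σ₁) * π σ₂ := by
        rw [← wordProd_append, List.cons_append, wordProd_cons, ← hprod, ← hw,
          simple_mul_simple_cancel_left]
      have h7 := cs.length_wordProd_le σ₂
      have h8 := cs.length_mul_le (π (i :: σ₁)) (π σ₂)
      have h9 := hω.eq
      rw [← h6] at h8
      rw [h6, isPrefix_mul_iff, ← h6]
      simp only [List.length_cons] at h9
      omega
    · obtain rfl := h2.eq_of_length (by omega)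
      rw [wordProd_append, wordProd_append, ← mul_assoc, mul_left_inj, ← wordProd_cons] at hprod
      have h6 := hω.eq
      have h7 := cs.length_wordProd_le σ₁
      rw [hprod, List.length_cons] at h6
      omega

variable [Finite W]

/-- The meet of two elements for the prefix order. -/
noncomputable def meet (x y : W) : W := (cs.exists_meet x y).choose

theorem isPrefix_meet_iff {x y z : W} :
    cs.IsPrefix z (cs.meet x y) ↔ cs.IsPrefix z x ∧ cs.IsPrefix z y :=
  (cs.exists_meet x y).choose_spec z

/-- The longest element of a finite Coxeter group. -/
noncomputable def longest : W := cs.exists_longest.choose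

theorem isPrefix_longest (x : W) : cs.IsPrefix x cs.longest := cs.exists_longest.choose_spec x

theorem longest_inv : cs.longest⁻¹ = cs.longest :=
  (cs.isPrefix_longest _).eq_of_length_le (by rw [length_inv])

theorem isPrefix_inv_mul_longest_iff {v z : W} :
    cs.IsPrefix z (v⁻¹ * cs.longest) ↔ ℓ (v * z) = ℓ v + ℓ z := by
  have h : ℓ (v * (v⁻¹ * cs.longest)) = ℓ v + ℓ (v⁻¹ * cs.longest) := by
    rw [mul_inv_cancel_left]
    exact (cs.isPrefix_longest v).symm
  refine ⟨fun hz => hz.length_mul h, fun hz => ?_⟩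
  rw [← cs.isPrefix_mul_left_iff hz h, mul_inv_cancel_left]
  exact cs.isPrefix_longest _

/-- The largest prefix `z` of `w` such that the lengths of `v` and `z` add up in `v * z`. -/
noncomputable def absorb (v w : W) : W := cs.meet w (v⁻¹ * cs.longest)

theorem isPrefix_absorb_iff {v w z : W} :
    cs.IsPrefix z (cs.absorb v w) ↔ cs.IsPrefix z w ∧ ℓ (v * z) = ℓ v + ℓ z := by
  rw [absorb, isPrefix_meet_iff, isPrefix_inv_mul_longest_iff]

theorem absorb_isPrefix (v w : W) : cs.IsPrefix (cs.absorb v w) w :=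
  (cs.isPrefix_absorb_iff.1 (cs.isPrefix_refl _)).1

theorem length_mul_absorb (v w : W) : ℓ (v * cs.absorb v w) = ℓ v + ℓ (cs.absorb v w) :=
  (cs.isPrefix_absorb_iff.1 (cs.isPrefix_refl _)).2

theorem absorb_mul {u v : W} (h : ℓ (u * v) = ℓ u + ℓ v) (w : W) :
    cs.absorb u (v * cs.absorb v w) = v * cs.absorb (u * v) w := by
  have h1 := cs.length_mul_absorb (u * v) w
  have h2 := cs.length_mul_le u (v * cs.absorb (u * v) w)
  have h3 := cs.length_mul_le v (cs.absorb (u * v) w)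
  rw [mul_assoc] at h1
  have hv : ℓ (v * cs.absorb (u * v) w) = ℓ v + ℓ (cs.absorb (u * v) w) := by omega
  have hle : cs.IsPrefix (v * cs.absorb (u * v) w) (cs.absorb u (v * cs.absorb v w)) := by
    rw [isPrefix_absorb_iff, cs.isPrefix_mul_left_iff hv (cs.length_mul_absorb v w),
      isPrefix_absorb_iff]
    exact ⟨⟨cs.absorb_isPrefix _ _, hv⟩, by omega⟩
  refine IsPrefix.antisymm ?_ hle
  obtain ⟨z, hz⟩ : ∃ z, cs.absorb u (v * cs.absorb v w) = v * z :=
    ⟨v⁻¹ * cs.absorb u (v * cs.absorb v w), (mul_inv_cancel_left _ _).symm⟩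
  have hvz := IsPrefix.left_of_mul hv hle
  rw [hz, isPrefix_mul_iff, eq_comm] at hvz
  have h4 := cs.absorb_isPrefix u (v * cs.absorb v w)
  have h5 := cs.length_mul_absorb u (v * cs.absorb v w)
  rw [hz] at h4 h5 ⊢
  rw [cs.isPrefix_mul_left_iff hvz (cs.length_mul_absorb v w)] at h4
  rw [cs.isPrefix_mul_left_iff hvz hv, isPrefix_absorb_iff, mul_assoc]
  exact ⟨h4.trans (cs.absorb_isPrefix v w), by omega⟩

end CoxeterSystem

namespace CoxeterSystem

open List

variable {B : Type*}

theorem reverse_alternatingWord (i j : B) (k : ℕ) :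
    (alternatingWord i j k).reverse =
      if Even k then alternatingWord j i k else alternatingWord i j k := by
  induction k generalizing i j with
  | zero => simp [alternatingWord]
  | succ k ih =>
    rw [alternatingWord_succ, List.concat_eq_append, List.reverse_append, ih]
    by_cases h : Even k
    · have h1 : ¬ Even (k + 1) := by simp [parity_simps, h]
      rw [if_pos h, if_neg h1, ← List.concat_eq_append, ← alternatingWord_succ,
        alternatingWord_succ', if_pos h]
      rfl
    · have h1 : Even (k + 1) := by simpa [parity_simps] using h
      rw [if_neg h, if_pos h1, alternatingWord_succ', if_neg h]
      rfl

end CoxeterSystem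

namespace CoxeterMatrix

open List CoxeterSystem

variable {B : Type*} (M : CoxeterMatrix B)

/-- The braid relations of a Coxeter matrix. -/
def braidRel (a b : FreeMonoid B) : Prop :=
  ∃ i j, a = FreeMonoid.ofList (braidWord M i j) ∧ b = FreeMonoid.ofList (braidWord M j i)

/-- The Artin monoid of a Coxeter matrix. -/
abbrev ArtinMonoid := PresentedMonoid M.braidRel

namespace ArtinMonoid

variable {M}

/-- The generators of the Artin monoid. -/
def gen (i : B) : M.ArtinMonoid := PresentedMonoid.of _ i

theorem mk_ofList (ω : List B) :
    PresentedMonoid.mk M.braidRel (FreeMonoid.ofList ω) = (ω.map gen).prod := by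
  induction ω with
  | nil => exact map_one _
  | cons i ω ih =>
    rw [FreeMonoid.ofList_cons, map_mul, ih]
    rfl

theorem exists_eq_prod (x : M.ArtinMonoid) : ∃ ω : List B, x = (ω.map gen).prod := by
  obtain ⟨a, rfl⟩ := PresentedMonoid.surjective_mk x
  exact ⟨a.toList, mk_ofList a.toList⟩

@[elab_as_elim]
theorem induction {p : M.ArtinMonoid → Prop} (x : M.ArtinMonoid) (one : p 1)
    (gen_mul : ∀ i x, p x → p (gen i * x)) : p x := by
  obtain ⟨ω, rfl⟩ := exists_eq_prod x
  induction ω with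
  | nil => exact one
  | cons i ω ih => exact gen_mul i _ ih

theorem prod_braidWord_eq (i j : B) :
    ((braidWord M i j).map gen).prod = ((braidWord M j i).map (gen (M := M))).prod := by
  rw [← mk_ofList, ← mk_ofList]
  exact PresentedMonoid.mk_eq_mk_of_rel ⟨i, j, rfl, rfl⟩

variable {N : Type*} [Monoid N]

/-- The homomorphism from the Artin monoid determined by a map that respects the braid
relations. -/
def lift (f : B → N)
    (hf : ∀ i j, ((braidWord M i j).map f).prod = ((braidWord M j i).map f).prod) :
    M.ArtinMonoid →* N :=
  PresentedMonoid.lift f (by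
    rintro _ _ ⟨i, j, rfl, rfl⟩
    simpa [FreeMonoid.lift_apply] using hf i j)

@[simp]
theorem lift_prod (f : B → N)
    (hf : ∀ i j, ((braidWord M i j).map f).prod = ((braidWord M j i).map f).prod) (ω : List B) :
    lift f hf (ω.map gen).prod = (ω.map f).prod := by
  rw [map_list_prod, List.map_map]
  rfl

/-- The number of letters of an element of the Artin monoid. -/
def degree : M.ArtinMonoid →* Multiplicative ℕ :=
  lift (fun _ => Multiplicative.ofAdd 1) fun i j => by simp [M.symmetric i j]

theorem degree_gen_mul (i : B) (x : M.ArtinMonoid) :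
    (degree (gen i * x)).toAdd = (degree x).toAdd + 1 := by
  rw [map_mul, toAdd_mul, add_comm]
  rfl

theorem eq_one_of_degree {x : M.ArtinMonoid} (h : (degree x).toAdd = 0) : x = 1 := by
  obtain ⟨ω, rfl⟩ := exists_eq_prod x
  cases ω with
  | nil => rfl
  | cons i ω =>
    rw [List.map_cons, List.prod_cons, degree_gen_mul] at h
    omega

theorem prod_map_op_gen (ω : List B) : (ω.map fun i => MulOpposite.op (gen (M := M) i)).prod =
    MulOpposite.op (ω.reverse.map gen).prod := by
  rw [MulOpposite.op_list_prod, List.map_reverse, List.map_reverse, List.reverse_reverse,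
    List.map_map]
  rfl

/-- The word reversal of the Artin monoid, as a homomorphism to the opposite monoid. -/
def revHom : M.ArtinMonoid →* M.ArtinMonoidᵐᵒᵖ :=
  lift (fun i => MulOpposite.op (gen i)) fun i j => by
    rw [prod_map_op_gen, prod_map_op_gen, braidWord, braidWord, reverse_alternatingWord,
      reverse_alternatingWord, M.symmetric j i]
    have h := prod_braidWord_eq (M := M) i j
    rw [braidWord, braidWord, M.symmetric j i] at h
    split_ifs
    · rw [h]
    · rw [h]

/-- The word reversal of the Artin monoid. -/
def rev (x : M.ArtinMonoid) : M.ArtinMonoid := (revHom x).unop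

@[simp]
theorem rev_one : rev (1 : M.ArtinMonoid) = 1 := by simp [rev]

@[simp]
theorem rev_gen (i : B) : rev (gen (M := M) i) = gen i := rfl

@[simp]
theorem rev_mul (x y : M.ArtinMonoid) : rev (x * y) = rev y * rev x := by simp [rev]

theorem rev_prod (ω : List B) : rev (ω.map (gen (M := M))).prod = (ω.reverse.map gen).prod := by
  rw [rev, revHom, lift_prod, prod_map_op_gen, MulOpposite.unop_op]

@[simp]
theorem rev_rev (x : M.ArtinMonoid) : rev (rev x) = x := by
  obtain ⟨ω, rfl⟩ := exists_eq_prod x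
  rw [rev_prod, rev_prod, List.reverse_reverse]

@[simp]
theorem rev_pow (x : M.ArtinMonoid) (n : ℕ) : rev (x ^ n) = rev x ^ n := by simp [rev]

end ArtinMonoid

end CoxeterMatrix

namespace CoxeterSystem

open List CoxeterMatrix CoxeterMatrix.ArtinMonoid

variable {B W : Type*} [Group W] {M : CoxeterMatrix B} (cs : CoxeterSystem M W)

local prefix:100 "s" => cs.simple
local prefix:100 "π" => cs.wordProd
local prefix:100 "ℓ" => cs.length

theorem braidWord_eq_cons {i j : B} (hM : M i j ≠ 0) :
    ∃ t t', (braidWord M i j = i :: t ∧ braidWord M j i = j :: t') ∨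
      (braidWord M j i = i :: t ∧ braidWord M i j = j :: t') := by
  obtain ⟨k, hk⟩ := Nat.exists_eq_succ_of_ne_zero hM
  simp only [braidWord, M.symmetric j i, hk, alternatingWord_succ', Nat.succ_eq_add_one]
  by_cases h : Even k
  · simp only [if_pos h]
    exact ⟨_, _, Or.inr ⟨rfl, rfl⟩⟩
  · simp only [if_neg h]
    exact ⟨_, _, Or.inl ⟨rfl, rfl⟩⟩

/-- The theorem of Matsumoto on reduced words. -/
theorem prod_gen_eq_of_isReduced {ω ω' : List B} (hω : cs.IsReduced ω) (hω' : cs.IsReduced ω')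
    (hM : ∀ i j, M i j ≠ 0) (h : π ω = π ω') :
    (ω.map gen).prod = (ω'.map (gen (M := M))).prod := by
  induction hn : ω.length generalizing ω ω' with
  | zero =>
    have h1 := hω'.eq
    rw [← h, hω.eq, hn, eq_comm, List.length_eq_zero_iff] at h1
    rw [List.length_eq_zero_iff.1 hn, h1]
  | succ n ih =>
    have hn' : ω'.length = n + 1 := by rw [← hω'.eq, ← h, hω.eq, hn]
    obtain ⟨i, a, rfl⟩ := List.exists_cons_of_length_eq_add_one hn
    obtain ⟨j, b, rfl⟩ := List.exists_cons_of_length_eq_add_one hn'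
    have ha : cs.IsReduced a := by simpa using hω.drop 1
    have hb : cs.IsReduced b := by simpa using hω'.drop 1
    simp only [List.length_cons, add_left_inj] at hn hn'
    by_cases hij : i = j
    · subst hij
      rw [wordProd_cons, wordProd_cons, mul_right_inj] at h
      rw [List.map_cons, List.map_cons, List.prod_cons, List.prod_cons, ih ha hb h hn]
    · have hd := cs.isPrefix_wordProd_braidWord hij (hM i j)
        (cs.isLeftDescent_of_isReduced_cons hω) (h ▸ cs.isLeftDescent_of_isReduced_cons hω')
      obtain ⟨ρ, hρ, hc⟩ := cs.exists_isReduced ((π (braidWord M i j))⁻¹ * π (i :: a))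
      have hdred := cs.isReduced_alternatingWord hij fun _ => le_rfl
      have hdred' := cs.isReduced_alternatingWord (Ne.symm hij) fun _ => le_rfl
      have hlen : M i j + ρ.length = n + 1 := by
        rw [IsPrefix, hc, hρ.eq, hdred.eq, hω.eq, length_alternatingWord, List.length_cons,
          hn] at hd
        exact hd
      have key (k : B) (e t : List B) (u : List B) (hu : u = k :: t) (he : cs.IsReduced e)
          (hen : e.length = n)
          (hul : u.length = M i j) (hud : π u = π (braidWord M i j))
          (hke : π (k :: e) = π (i :: a)) :
          ((k :: e).map gen).prod = (u.map (gen (M := M))).prod * (ρ.map gen).prod := by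
        have h1 : π (k :: (t ++ ρ)) = π (k :: e) := by
          rw [← List.cons_append, ← hu, wordProd_append, hud, ← hc, mul_inv_cancel_left, hke]
        have h2 : cs.IsReduced (k :: (t ++ ρ)) := by
          rw [IsReduced, h1, hke, hω.eq, ← List.cons_append, ← hu, List.length_append,
            List.length_cons]
          omega
        have h3 : cs.IsReduced (t ++ ρ) := by simpa using h2.drop 1
        rw [wordProd_cons, wordProd_cons, mul_right_inj] at h1
        rw [List.map_cons, List.prod_cons, ih he h3 h1.symm hen, ← List.prod_append,
          ← List.map_append, hu, List.cons_append, List.map_cons, List.prod_cons]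
      have hl : (braidWord M i j).length = M i j := length_alternatingWord _ _ _
      have hl' : (braidWord M j i).length = M i j := by
        rw [M.symmetric i j]
        exact length_alternatingWord _ _ _
      have hπ := cs.wordProd_braidWord_eq j i
      obtain ⟨t, t', ⟨h1, h2⟩ | ⟨h1, h2⟩⟩ := braidWord_eq_cons (hM i j)
      · rw [key i a t _ h1 ha hn hl rfl rfl, key j b t' _ h2 hb hn' hl' hπ h.symm,
          prod_braidWord_eq]
      · rw [key i a t _ h1 ha hn hl' hπ rfl, key j b t' _ h2 hb hn' hl rfl h.symm,
          prod_braidWord_eq]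

/-- The projection from the Artin monoid to the Coxeter group. -/
def ofArtinMonoid : M.ArtinMonoid →* W := ArtinMonoid.lift cs.simple cs.wordProd_braidWord_eq

@[simp]
theorem ofArtinMonoid_gen (i : B) : cs.ofArtinMonoid (gen i) = s i := rfl

theorem ofArtinMonoid_prod (ω : List B) : cs.ofArtinMonoid (ω.map gen).prod = π ω :=
  lift_prod _ _ _

theorem ofArtinMonoid_rev (x : M.ArtinMonoid) :
    cs.ofArtinMonoid (rev x) = (cs.ofArtinMonoid x)⁻¹ := by
  obtain ⟨ω, rfl⟩ := exists_eq_prod x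
  rw [rev_prod, ofArtinMonoid_prod, ofArtinMonoid_prod, wordProd_reverse]

variable [Finite W]

/-- The lift of an element of the Coxeter group to the Artin monoid along a reduced word. -/
noncomputable def posLift (w : W) : M.ArtinMonoid :=
  ((cs.exists_isReduced w).choose.map gen).prod

theorem posLift_wordProd {ω : List B} (hω : cs.IsReduced ω) :
    cs.posLift (π ω) = (ω.map gen).prod := by
  obtain ⟨h1, h2⟩ := (cs.exists_isReduced (π ω)).choose_spec
  exact cs.prod_gen_eq_of_isReduced h1 hω cs.coxeterMatrix_ne_zero h2.symm

@[simp]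
theorem posLift_one : cs.posLift 1 = 1 := by
  rw [← wordProd_nil cs, posLift_wordProd]
  · rfl
  · simp [IsReduced]

@[simp]
theorem posLift_simple (i : B) : cs.posLift (s i) = gen i := by
  rw [← wordProd_singleton, posLift_wordProd]
  · simp
  · simp [IsReduced]

theorem posLift_mul {x y : W} (h : ℓ (x * y) = ℓ x + ℓ y) :
    cs.posLift (x * y) = cs.posLift x * cs.posLift y := by
  obtain ⟨ω, hω, rfl⟩ := cs.exists_isReduced x
  obtain ⟨ρ, hρ, rfl⟩ := cs.exists_isReduced y
  rw [cs.posLift_wordProd hω, cs.posLift_wordProd hρ, ← wordProd_append, posLift_wordProd,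
    List.map_append, List.prod_append]
  rw [IsReduced, wordProd_append, h, hω.eq, hρ.eq, List.length_append]

theorem IsPrefix.posLift_eq_mul {x y : W} (h : cs.IsPrefix x y) :
    cs.posLift y = cs.posLift x * cs.posLift (x⁻¹ * y) := by
  rw [← posLift_mul, mul_inv_cancel_left]
  rw [mul_inv_cancel_left, h]

@[simp]
theorem ofArtinMonoid_posLift (w : W) : cs.ofArtinMonoid (cs.posLift w) = w := by
  obtain ⟨ω, hω, rfl⟩ := cs.exists_isReduced w
  rw [cs.posLift_wordProd hω, ofArtinMonoid_prod]

@[simp]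
theorem rev_posLift (w : W) : rev (cs.posLift w) = cs.posLift w⁻¹ := by
  obtain ⟨ω, hω, rfl⟩ := cs.exists_isReduced w
  rw [cs.posLift_wordProd hω, rev_prod, ← wordProd_reverse, posLift_wordProd]
  rwa [isReduced_reverse_iff]

end CoxeterSystem

namespace CoxeterSystem

open List CoxeterMatrix CoxeterMatrix.ArtinMonoid

variable {B W : Type*} [Group W] {M : CoxeterMatrix B} (cs : CoxeterSystem M W)

local prefix:100 "s" => cs.simple
local prefix:100 "π" => cs.wordProd
local prefix:100 "ℓ" => cs.length

/-- Products of `n` simple elements of the Artin monoid. -/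
def IsSimpleProd (n : ℕ) (x : M.ArtinMonoid) : Prop :=
  ∃ l : List W, l.length = n ∧ (l.map cs.posLift).prod = x

theorem IsSimpleProd.cons {cs : CoxeterSystem M W} {n : ℕ} {x : M.ArtinMonoid}
    (h : cs.IsSimpleProd n x) (w : W) :
    cs.IsSimpleProd (n + 1) (cs.posLift w * x) := by
  obtain ⟨l, rfl, rfl⟩ := h
  exact ⟨w :: l, by simp, by simp⟩

variable [Finite W]

/-- Multiplication by the positive lift of `v` on pairs `(w, x)`, which stand for
`cs.posLift w * x`, where as many letters as possible are moved into the first component. -/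
noncomputable def absorbMap (v : W) : Function.End (W × M.ArtinMonoid) :=
  fun p => (v * cs.absorb v p.1, cs.posLift ((cs.absorb v p.1)⁻¹ * p.1) * p.2)

theorem absorb_one_left (w : W) : cs.absorb 1 w = w :=
  (cs.absorb_isPrefix 1 w).antisymm ((cs.isPrefix_absorb_iff).2 ⟨cs.isPrefix_refl w, by simp⟩)

theorem absorb_one_right (v : W) : cs.absorb v 1 = 1 := (cs.absorb_isPrefix v 1).eq_one

theorem absorbMap_one : cs.absorbMap 1 = 1 := by
  funext ⟨w, x⟩
  simp only [absorbMap, absorb_one_left, inv_mul_cancel, posLift_one, one_mul]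
  rfl

theorem absorbMap_mul {u v : W} (h : ℓ (u * v) = ℓ u + ℓ v) :
    cs.absorbMap (u * v) = cs.absorbMap u * cs.absorbMap v := by
  funext ⟨w, x⟩
  have h1 := cs.absorb_isPrefix v w
  have h2 := cs.absorb_isPrefix (u * v) w
  have h3 : cs.IsPrefix (cs.absorb (u * v) w) (cs.absorb v w) := by
    rw [isPrefix_absorb_iff]
    refine ⟨h2, ?_⟩
    have h4 := cs.length_mul_absorb (u * v) w
    have h5 := cs.length_mul_le u (v * cs.absorb (u * v) w)
    have h6 := cs.length_mul_le v (cs.absorb (u * v) w)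
    rw [mul_assoc] at h4
    omega
  have h4 : cs.posLift ((cs.absorb (u * v) w)⁻¹ * w) =
      cs.posLift ((cs.absorb (u * v) w)⁻¹ * cs.absorb v w) *
        cs.posLift ((cs.absorb v w)⁻¹ * w) := by
    unfold IsPrefix at h1 h2 h3
    rw [← posLift_mul, mul_assoc, mul_inv_cancel_left]
    rw [mul_assoc, mul_inv_cancel_left]
    omega
  change (_, _) = cs.absorbMap u (cs.absorbMap v (w, x))
  simp only [absorbMap, cs.absorb_mul h, h4]
  ext
  · simp only [mul_assoc]
  · simp only [mul_inv_rev, mul_assoc, inv_mul_cancel_left]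

theorem prod_map_absorbMap {ω : List B} (hω : cs.IsReduced ω) :
    (ω.map fun i => cs.absorbMap (s i)).prod = cs.absorbMap (π ω) := by
  induction ω with
  | nil => simp [absorbMap_one]
  | cons i ω ih =>
    have hω' : cs.IsReduced ω := by simpa using hω.drop 1
    have h := hω.eq
    rw [wordProd_cons] at h
    rw [List.map_cons, List.prod_cons, ih hω', wordProd_cons, absorbMap_mul]
    rw [h, hω'.eq, length_simple, List.length_cons, add_comm]

/-- The action of the Artin monoid generated by the maps `cs.absorbMap`. -/
noncomputable def absorbHom : M.ArtinMonoid →* Function.End (W × M.ArtinMonoid) :=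
  ArtinMonoid.lift (fun i => cs.absorbMap (s i)) fun i j => by
    by_cases hij : i = j
    · rw [hij]
    · rw [cs.prod_map_absorbMap (cs.isReduced_alternatingWord hij fun _ => le_rfl),
        cs.prod_map_absorbMap (cs.isReduced_alternatingWord (Ne.symm hij) fun _ => le_rfl),
        wordProd_braidWord_eq]

theorem absorbHom_posLift (v : W) : cs.absorbHom (cs.posLift v) = cs.absorbMap v := by
  obtain ⟨ω, hω, rfl⟩ := cs.exists_isReduced v
  rw [cs.posLift_wordProd hω, absorbHom, lift_prod, cs.prod_map_absorbMap hω]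

/-- The largest simple prefix of an element of the Artin monoid. -/
noncomputable def head (x : M.ArtinMonoid) : W := (cs.absorbHom x (1, 1)).1

/-- The element left after removal of the largest simple prefix. -/
noncomputable def tail (x : M.ArtinMonoid) : M.ArtinMonoid := (cs.absorbHom x (1, 1)).2

theorem absorbHom_posLift_mul (v : W) (x : M.ArtinMonoid) :
    cs.absorbHom (cs.posLift v * x) (1, 1) = cs.absorbMap v (cs.head x, cs.tail x) := by
  rw [map_mul, absorbHom_posLift]
  rfl

theorem head_posLift_mul (v : W) (x : M.ArtinMonoid) :
    cs.head (cs.posLift v * x) = v * cs.absorb v (cs.head x) := by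
  rw [head, absorbHom_posLift_mul]
  rfl

theorem tail_posLift_mul (v : W) (x : M.ArtinMonoid) :
    cs.tail (cs.posLift v * x) =
      cs.posLift ((cs.absorb v (cs.head x))⁻¹ * cs.head x) * cs.tail x := by
  rw [tail, absorbHom_posLift_mul]
  rfl

@[simp]
theorem head_one : cs.head 1 = 1 := by
  rw [head, map_one]
  rfl

@[simp]
theorem tail_one : cs.tail 1 = 1 := by
  rw [tail, map_one]
  rfl

theorem posLift_head_mul_tail (x : M.ArtinMonoid) : cs.posLift (cs.head x) * cs.tail x = x := by
  induction x using ArtinMonoid.induction with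
  | one => simp
  | gen_mul i x ih =>
    rw [← cs.posLift_simple, head_posLift_mul, tail_posLift_mul,
      cs.posLift_mul (cs.length_mul_absorb _ _), mul_assoc,
      ← mul_assoc (cs.posLift (cs.absorb _ _)),
      ← (cs.absorb_isPrefix _ _).posLift_eq_mul, ih]

theorem isPrefix_head_posLift_mul (v : W) (x : M.ArtinMonoid) :
    cs.IsPrefix v (cs.head (cs.posLift v * x)) := by
  rw [head_posLift_mul, isPrefix_mul_iff, length_mul_absorb]

theorem posLift_mul_tail_posLift_mul (v : W) (x : M.ArtinMonoid) :
    cs.posLift (v⁻¹ * cs.head (cs.posLift v * x)) * cs.tail (cs.posLift v * x) = x := by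
  rw [head_posLift_mul, tail_posLift_mul, inv_mul_cancel_left, ← mul_assoc,
    ← (cs.absorb_isPrefix _ _).posLift_eq_mul, posLift_head_mul_tail]

theorem isCancelMul_artinMonoid (cs : CoxeterSystem M W) : IsCancelMul M.ArtinMonoid := by
  have key (x y z : M.ArtinMonoid) (h : x * y = x * z) : y = z := by
    induction x using ArtinMonoid.induction with
    | one => simpa using h
    | gen_mul i x ih =>
      rw [mul_assoc, mul_assoc, ← cs.posLift_simple] at h
      refine ih ?_
      rw [← cs.posLift_mul_tail_posLift_mul (cs.simple i) (x * y), h, posLift_mul_tail_posLift_mul]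
  refine { mul_left_cancel := key, mul_right_cancel := fun x y z h => ?_ }
  have h1 := congrArg rev h
  simp only [rev_mul] at h1
  rw [← rev_rev y, key _ _ _ h1, rev_rev]

/-- The Garside element. -/
noncomputable def garside : M.ArtinMonoid := cs.posLift cs.longest

@[simp]
theorem rev_garside : rev cs.garside = cs.garside := by
  rw [garside, rev_posLift, longest_inv]

theorem posLift_mul_posLift_inv_mul_longest (w : W) :
    cs.posLift w * cs.posLift (w⁻¹ * cs.longest) = cs.garside :=
  (cs.isPrefix_longest w).posLift_eq_mul.symm

theorem posLift_longest_mul_inv_mul_posLift (w : W) :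
    cs.posLift (cs.longest * w⁻¹) * cs.posLift w = cs.garside := by
  have h := congrArg rev (cs.posLift_mul_posLift_inv_mul_longest w⁻¹)
  simpa [longest_inv] using h

theorem exists_gen_mul_garside (i : B) :
    ∃ j, gen i * cs.garside = cs.garside * gen j := by
  have h1 := cs.isPrefix_longest (s i)
  have h2 := cs.isPrefix_longest (cs.longest⁻¹ * s i * cs.longest)⁻¹
  have h3 := cs.length_inv ((s i)⁻¹ * cs.longest)
  have h4 : (cs.longest⁻¹ * s i * cs.longest)⁻¹⁻¹ * cs.longest = ((s i)⁻¹ * cs.longest)⁻¹ := by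
    have h : cs.longest * cs.longest = 1 := by
      nth_rw 1 [← longest_inv]
      exact inv_mul_cancel _
    rw [inv_inv, mul_assoc, h, mul_one, mul_inv_rev, inv_inv]
  rw [IsPrefix, h4, h3, length_inv] at h2
  have h5 : ℓ (cs.longest⁻¹ * s i * cs.longest) = 1 := by
    rw [IsPrefix, length_simple] at h1
    omega
  obtain ⟨j, hj⟩ := cs.length_eq_one_iff.1 h5
  refine ⟨j, ?_⟩
  have h6 := cs.posLift_mul_posLift_inv_mul_longest (s i)
  have h7 := cs.posLift_longest_mul_inv_mul_posLift (s j)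
  have h8 : cs.longest * (s j)⁻¹ = (s i)⁻¹ * cs.longest := by
    rw [← hj]
    group
  rw [h8] at h7
  rw [posLift_simple] at h6 h7
  conv_lhs => rw [← h7, ← mul_assoc, h6]

theorem exists_mul_garside_pow (x : M.ArtinMonoid) (n : ℕ) :
    ∃ y, x * cs.garside ^ n = cs.garside ^ n * y := by
  have key (x : M.ArtinMonoid) : ∃ y, x * cs.garside = cs.garside * y := by
    induction x using ArtinMonoid.induction with
    | one => exact ⟨1, by simp⟩
    | gen_mul i x ih =>
      obtain ⟨y, hy⟩ := ih
      obtain ⟨j, hj⟩ := cs.exists_gen_mul_garside i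
      exact ⟨gen j * y, by rw [mul_assoc, hy, ← mul_assoc, hj, mul_assoc]⟩
  induction n generalizing x with
  | zero => exact ⟨x, by simp⟩
  | succ n ih =>
    obtain ⟨y, hy⟩ := ih x
    obtain ⟨z, hz⟩ := key y
    exact ⟨z, by rw [pow_succ, ← mul_assoc, hy, mul_assoc, hz, mul_assoc]⟩

theorem exists_garside_pow_mul (x : M.ArtinMonoid) (n : ℕ) :
    ∃ y, cs.garside ^ n * x = y * cs.garside ^ n := by
  obtain ⟨y, hy⟩ := cs.exists_mul_garside_pow (rev x) n
  have h := congrArg rev hy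
  simp only [rev_mul, rev_pow, rev_garside, rev_rev] at h
  exact ⟨_, h⟩

variable {cs}

theorem IsSimpleProd.tail {n : ℕ} {x : M.ArtinMonoid} (h : cs.IsSimpleProd (n + 1) x) :
    cs.IsSimpleProd n (cs.tail x) := by
  obtain ⟨l, hl, rfl⟩ := h
  induction n generalizing l with
  | zero =>
    obtain ⟨w, rfl⟩ := List.length_eq_one_iff.1 hl
    refine ⟨[], rfl, ?_⟩
    rw [List.map_singleton, List.prod_singleton, ← mul_one (cs.posLift w), tail_posLift_mul]
    simp [absorb_one_right]
  | succ n ih =>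
    obtain ⟨w, l, rfl⟩ := List.exists_cons_of_length_eq_add_one hl
    rw [List.map_cons, List.prod_cons, tail_posLift_mul]
    exact (ih l (by simpa using hl)).cons _

theorem IsSimpleProd.of_mul {n : ℕ} {x y : M.ArtinMonoid} (h : cs.IsSimpleProd n (x * y)) :
    cs.IsSimpleProd n y := by
  induction x using ArtinMonoid.induction with
  | one => simpa using h
  | gen_mul i x ih =>
    refine ih ?_
    rw [mul_assoc] at h
    cases n with
    | zero =>
      obtain ⟨l, hl, h⟩ := h
      rw [List.length_eq_zero_iff.1 hl] at h
      have h1 := degree_gen_mul i (x * y)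
      rw [← h, List.map_nil, List.prod_nil, map_one, toAdd_one] at h1
      omega
    | succ n =>
      rw [← cs.posLift_simple] at h
      rw [← cs.posLift_mul_tail_posLift_mul (cs.simple i) (x * y)]
      exact h.tail.cons _

theorem IsSimpleProd.exists_mul_eq {n : ℕ} {x : M.ArtinMonoid} (h : cs.IsSimpleProd n x) :
    ∃ y, x * y = cs.garside ^ n := by
  obtain ⟨l, rfl, rfl⟩ := h
  induction l with
  | nil => exact ⟨1, by simp⟩
  | cons w l ih =>
    obtain ⟨y, hy⟩ := ih
    obtain ⟨z, hz⟩ := cs.exists_mul_garside_pow (cs.posLift (w⁻¹ * cs.longest)) l.length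
    refine ⟨y * z, ?_⟩
    rw [List.map_cons, List.prod_cons, mul_assoc, ← mul_assoc _ y, hy, ← hz, ← mul_assoc,
      posLift_mul_posLift_inv_mul_longest, List.length_cons, pow_succ']

variable (cs)

theorem isSimpleProd_prod (ω : List B) : cs.IsSimpleProd ω.length (ω.map gen).prod :=
  ⟨ω.map cs.simple, by simp, by rw [List.map_map]; congr 2; funext i; simp⟩

theorem exists_mul_eq_garside_pow (x : M.ArtinMonoid) : ∃ n y, x * y = cs.garside ^ n := by
  obtain ⟨ω, rfl⟩ := exists_eq_prod x
  exact ⟨_, (cs.isSimpleProd_prod ω).exists_mul_eq⟩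

theorem eq_garside_pow_of_mul_rev {x : M.ArtinMonoid} {n : ℕ}
    (h : x * rev x = cs.garside ^ (2 * n)) : x = cs.garside ^ n := by
  have := cs.isCancelMul_artinMonoid
  induction n generalizing x with
  | zero =>
    have h1 := congrArg (fun y => (degree y).toAdd) h
    simp only [map_mul, toAdd_mul, mul_zero, pow_zero, map_one, toAdd_one] at h1
    rw [pow_zero]
    exact eq_one_of_degree (by omega)
  | succ n ih =>
    have hS : cs.IsSimpleProd (2 * n + 1 + 1) (rev x) := by
      refine IsSimpleProd.of_mul (x := x) ?_
      rw [h]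
      exact ⟨List.replicate _ cs.longest, List.length_replicate, by simp [garside]; rfl⟩
    obtain ⟨e, he⟩ := hS.tail.exists_mul_eq
    set c := cs.tail (rev x)
    have hx : cs.posLift (cs.head (rev x)) * c = rev x := cs.posLift_head_mul_tail (rev x)
    set y := cs.head (rev x) with hy
    obtain ⟨e', he'⟩ := cs.exists_garside_pow_mul e (2 * (n + 1))
    have h1 : x * cs.posLift y = e' * cs.garside := by
      apply mul_right_cancel (b := cs.garside ^ (2 * n + 1))
      rw [mul_assoc e', ← pow_succ', show 2 * n + 1 + 1 = 2 * (n + 1) by ring, ← he', ← h, ← he,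
        ← hx]
      simp only [mul_assoc]
    rw [← cs.posLift_longest_mul_inv_mul_posLift y, ← mul_assoc] at h1
    have h2 := congrArg rev (mul_right_cancel h1)
    rw [rev_mul, rev_posLift] at h2
    have h3 : cs.IsPrefix (cs.longest * y⁻¹)⁻¹ y := by
      conv_rhs => rw [hy, h2]
      exact cs.isPrefix_head_posLift_mul _ _
    have h4 : y = cs.longest := by
      refine (cs.isPrefix_longest y).eq_of_length_le ?_
      rw [IsPrefix, inv_inv, inv_mul_cancel_right] at h3
      omega
    rw [h4] at hx
    change cs.garside * _ = _ at hx
    have hx' : x = rev c * cs.garside := by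
      rw [← rev_rev x, ← hx]
      simp
    obtain ⟨d, hd⟩ := cs.exists_mul_garside_pow (rev c) 1
    rw [pow_one, ← hx'] at hd
    rw [hd, rev_mul, rev_garside, show 2 * (n + 1) = 1 + 2 * n + 1 by ring, pow_succ, pow_add,
      pow_one, ← mul_assoc, mul_assoc cs.garside] at h
    rw [hd, pow_succ', ih (mul_left_cancel (mul_right_cancel h))]

theorem exists_eq_mul_rev {p : M.ArtinMonoid} (hrev : rev p = p) (hp : cs.ofArtinMonoid p = 1) :
    ∃ x, p = x * rev x := by
  have := cs.isCancelMul_artinMonoid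
  induction hn : (degree p).toAdd using Nat.strong_induction_on generalizing p with
  | _ n ih =>
  have hpt := cs.posLift_head_mul_tail p
  obtain ⟨ω, hω⟩ := exists_eq_prod (rev (cs.tail p))
  cases ω with
  | nil =>
    have h1 : cs.tail p = 1 := by rw [← rev_rev (cs.tail p), hω]; simp
    rw [h1, mul_one] at hpt
    rw [← hpt, ofArtinMonoid_posLift] at hp
    exact ⟨1, by rw [← hpt, hp]; simp⟩
  | cons i ω =>
    rw [List.map_cons, List.prod_cons] at hω
    set t := rev (ω.map gen).prod with ht
    have h1 : cs.tail p = t * gen i := by rw [← rev_rev (cs.tail p), hω]; simp [ht]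
    have h2 : p = cs.posLift (s i) * rev (cs.posLift (cs.head p) * t) := by
      conv_lhs => rw [← hrev, ← hpt, h1]
      simp [mul_assoc]
    have h3 : cs.IsPrefix (s i) (cs.head p) := by
      conv_rhs => rw [h2]
      exact cs.isPrefix_head_posLift_mul _ _
    set q := cs.posLift ((s i)⁻¹ * cs.head p) * t with hq
    have h4 : p = gen i * q * gen i := by
      conv_lhs => rw [← hpt, h1, h3.posLift_eq_mul, posLift_simple]
      simp only [mul_assoc, hq]
    clear_value q
    have hqrev : rev q = q := by
      have h5 := hrev
      rw [h4] at h5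
      simp only [rev_mul, rev_gen, ← mul_assoc] at h5
      exact mul_left_cancel (mul_right_cancel h5)
    have hq1 : cs.ofArtinMonoid q = 1 := by
      rw [h4, map_mul, map_mul, ofArtinMonoid_gen] at hp
      have h5 := congrArg (fun w => s i * w * s i) hp
      simpa [← mul_assoc] using h5
    have hdeg : (degree q).toAdd < n := by
      rw [← hn, h4, mul_assoc, degree_gen_mul, map_mul, toAdd_mul]
      omega
    obtain ⟨x, hx⟩ := ih _ hdeg hqrev hq1 rfl
    refine ⟨gen i * x, ?_⟩
    rw [h4, hx, rev_mul, rev_gen]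
    simp only [mul_assoc]

end CoxeterSystem

theorem lift_artinWord {B G : Type*} [Group G] (f : B → G) (k : ℕ) (i j : B) :
    FreeGroup.lift f (artinWord k i j) =
      ((CoxeterSystem.alternatingWord j i k).reverse.map f).prod := by
  induction k generalizing i j with
  | zero => simp [artinWord, CoxeterSystem.alternatingWord]
  | succ k ih =>
    rw [artinWord, map_mul, ih, CoxeterSystem.alternatingWord_succ]
    simp

namespace CoxeterMatrix

open List CoxeterSystem

variable {B : Type*} (M : CoxeterMatrix B)

theorem lift_artinWord_eq_iff {G : Type*} [Group G] (f : B → G) (i j : B) :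
    FreeGroup.lift f (artinWord (M i j) i j) = FreeGroup.lift f (artinWord (M i j) j i) ↔
      ((braidWord M i j).map f).prod = ((braidWord M j i).map f).prod := by
  rw [lift_artinWord, lift_artinWord, reverse_alternatingWord, reverse_alternatingWord,
    braidWord, braidWord, M.symmetric j i]
  split_ifs
  · rfl
  · exact eq_comm

theorem prod_braidWord_map_artinGen (i j : B) :
    ((braidWord M i j).map (artinGen fun i j => M i j)).prod =
      ((braidWord M j i).map (artinGen fun i j => M i j)).prod := by
  rw [← lift_artinWord_eq_iff]
  by_cases hij : i = j
  · rw [hij]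
  · by_cases hM : M i j = 0
    · rw [hM]
      rfl
    · have h : FreeGroup.lift (artinGen fun i j => M i j) =
          (PresentedGroup.mk (artinRels fun i j => M i j)) :=
        FreeGroup.ext_hom _ _ fun i => FreeGroup.lift_apply_of
      rw [h]
      exact PresentedGroup.mk_eq_mk_of_mul_inv_mem ⟨i, j, hij, hM, rfl⟩

namespace ArtinMonoid

/-- The homomorphism from the Artin monoid to the Artin group. -/
def toArtinGroup : M.ArtinMonoid →* ArtinGroup fun i j => M i j :=
  lift (artinGen fun i j => M i j) M.prod_braidWord_map_artinGen

variable {M}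

theorem exists_comp_toArtinGroup_eq {G : Type*} [Group G] (f : M.ArtinMonoid →* G) :
    ∃ F : (ArtinGroup fun i j => M i j) →* G, F.comp (toArtinGroup M) = f := by
  have h : ∀ r ∈ artinRels fun i j => M i j, FreeGroup.lift (fun i => f (gen i)) r = 1 := by
    rintro _ ⟨i, j, -, -, rfl⟩
    rw [map_mul, map_inv, mul_inv_eq_one, lift_artinWord_eq_iff]
    have := congrArg f (prod_braidWord_eq (M := M) i j)
    simpa [map_list_prod, Function.comp_def] using this
  let F : (ArtinGroup fun i j => M i j) →* G := PresentedGroup.toGroup h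
  refine ⟨F, MonoidHom.ext fun x => ?_⟩
  induction x using ArtinMonoid.induction with
  | one => rw [map_one, map_one]
  | gen_mul i x ih =>
    rw [map_mul, map_mul, ih]
    congr 1
    exact PresentedGroup.toGroup.of h

end ArtinMonoid

end CoxeterMatrix

/-- A cancellative monoid in which any two elements have a common left multiple embeds in a
group. -/
theorem exists_injective_hom_group.{u} {R : Type u} [Monoid R] [IsCancelMul R]
    (h : ∀ r s : R, ∃ u v : R, u * r = v * s) :
    ∃ (G : Type u) (_ : Group G) (f : R →* G), Function.Injective f := by
  choose u v huv using h
  let inst : OreLocalization.OreSet (⊤ : Submonoid R) :=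
    { ore_right_cancel := fun r₁ r₂ s h => ⟨1, by rw [mul_right_cancel h]⟩
      oreNum := fun r s => v r s
      oreDenom := fun r s => ⟨u r s, trivial⟩
      ore_eq := fun r s => huv r s }
  let φ : R →* OreLocalization (⊤ : Submonoid R) R := OreLocalization.numeratorHom
  have hφ : Function.Injective φ := fun r r' hr => by
    rw [OreLocalization.numeratorHom_apply, OreLocalization.numeratorHom_apply,
      OreLocalization.oreDiv_eq_iff] at hr
    obtain ⟨a, b, h1, h2⟩ := hr
    rw [Submonoid.coe_one, mul_one, mul_one] at h2
    rw [Submonoid.smul_def, h2] at h1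
    exact (mul_left_cancel h1).symm
  refine ⟨(OreLocalization (⊤ : Submonoid R) R)ˣ, inferInstance,
    { toFun := fun r => OreLocalization.numeratorUnit ⟨r, trivial⟩
      map_one' := Units.ext (map_one φ)
      map_mul' := fun r r' => Units.ext (map_mul φ r r') }, fun r r' hr => ?_⟩
  have h := congrArg Units.val hr
  exact hφ h

namespace CoxeterSystem

open CoxeterMatrix CoxeterMatrix.ArtinMonoid

variable {B W : Type*} [Group W] {M : CoxeterMatrix B} (cs : CoxeterSystem M W) [Finite W]

theorem toArtinGroup_injective {B W : Type*} [Group W] {M : CoxeterMatrix B}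
    (cs : CoxeterSystem M W) [Finite W] : Function.Injective (toArtinGroup M) := by
  have := cs.isCancelMul_artinMonoid
  obtain ⟨G, _, f, hf⟩ := exists_injective_hom_group (R := M.ArtinMonoid) fun r s => by
    obtain ⟨n, y, hy⟩ := cs.exists_mul_eq_garside_pow (rev s)
    obtain ⟨r', hr⟩ := cs.exists_garside_pow_mul r n
    refine ⟨cs.garside ^ n, r' * rev y, ?_⟩
    have := congrArg rev hy
    rw [rev_mul, rev_rev, rev_pow, cs.rev_garside] at this
    rw [hr, mul_assoc, this]
  obtain ⟨F, hF⟩ := exists_comp_toArtinGroup_eq f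
  rw [← hF, MonoidHom.coe_comp] at hf
  exact hf.of_comp

theorem exists_garside_pow_mul_eq (x : ArtinGroup fun i j => M i j) :
    ∃ n b, toArtinGroup M (cs.garside ^ n) * x = toArtinGroup M b := by
  let S : Subgroup (ArtinGroup fun i j => M i j) :=
    { carrier := { x | ∃ n b, toArtinGroup M (cs.garside ^ n) * x = toArtinGroup M b }
      one_mem' := ⟨0, 1, by simp⟩
      mul_mem' := by
        rintro x y ⟨n, b, hx⟩ ⟨m, c, hy⟩
        obtain ⟨b', hb⟩ := cs.exists_garside_pow_mul b m
        refine ⟨m + n, b' * c, ?_⟩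
        rw [pow_add, map_mul, mul_assoc, ← mul_assoc _ x, hx, ← mul_assoc, ← map_mul, hb, map_mul,
          mul_assoc, hy, map_mul]
      inv_mem' := by
        rintro x ⟨n, b, hx⟩
        obtain ⟨m, y, hy⟩ := cs.exists_mul_eq_garside_pow (rev b)
        have h := congrArg rev hy
        rw [rev_mul, rev_rev, rev_pow, cs.rev_garside] at h
        refine ⟨m, rev y * cs.garside ^ n, ?_⟩
        rw [← h, map_mul, map_mul, ← hx]
        group }
  have hS : Set.range (artinGen fun i j => M i j) ⊆ S := by
    rintro _ ⟨i, rfl⟩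
    refine ⟨0, gen i, ?_⟩
    rw [pow_zero, map_one, one_mul]
    rfl
  have h := (Subgroup.closure_le S).2 hS
  have hx : x ∈ Subgroup.closure (Set.range (artinGen fun i j => M i j)) :=
    (PresentedGroup.closure_range_of (artinRels fun i j => M i j)).ge (Subgroup.mem_top x)
  exact h hx

end CoxeterSystem

/-- Let `M` be a Coxeter matrix of finite type (the Coxeter group `M.Group`
is finite).  Let `rev` be the (unique) involutive anti-automorphism of the Artin group `A(M)`
fixing each Artin generator, and let `π : A(M) → W(M)` be the natural projection onto the
Coxeter group.  Then the palindromization map `x ↦ x * rev x` is injective and its image is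
exactly the set of pure palindromes. -/
theorem palindromization_injective_and_range_eq_pure_palindromes
    {B : Type*} (M : CoxeterMatrix B) [Finite M.Group]
    (rev : ArtinGroup (fun i j => M i j) → ArtinGroup (fun i j => M i j))
    (hmul : ∀ x y, rev (x * y) = rev y * rev x)
    (hinv : ∀ x, rev (rev x) = x)
    (hgen : ∀ i : B, rev (artinGen (fun i j => M i j) i) = artinGen (fun i j => M i j) i)
    (π : ArtinGroup (fun i j => M i j) →* M.Group)
    (hπ : ∀ i : B, π (artinGen (fun i j => M i j) i) = M.simple i) :
    Function.Injective (fun x => x * rev x) ∧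
      Set.range (fun x : ArtinGroup (fun i j => M i j) => x * rev x) =
        { x : ArtinGroup (fun i j => M i j) | π x = 1 ∧ rev x = x } := by
  let cs := M.toCoxeterSystem
  let ι := CoxeterMatrix.ArtinMonoid.toArtinGroup M
  let Δ := cs.garside
  have hι : Function.Injective ι := cs.toArtinGroup_injective
  have hrev_one : rev 1 = 1 := by simpa using hmul 1 (rev 1)
  have hrev_inv (x) : rev x⁻¹ = (rev x)⁻¹ := by
    rw [eq_inv_iff_mul_eq_one, ← hmul, mul_inv_cancel, hrev_one]
  have hrev_ι (b) : rev (ι b) = ι (b.rev) := by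
    induction b using CoxeterMatrix.ArtinMonoid.induction with
    | one => rw [map_one, CoxeterMatrix.ArtinMonoid.rev_one, map_one, hrev_one]
    | gen_mul i x ih =>
      rw [map_mul, hmul, ih, CoxeterMatrix.ArtinMonoid.rev_mul, map_mul,
        CoxeterMatrix.ArtinMonoid.rev_gen]
      exact congrArg _ (hgen i)
  have hπ_ι (b) : π (ι b) = cs.ofArtinMonoid b := by
    induction b using CoxeterMatrix.ArtinMonoid.induction with
    | one => rw [map_one, map_one, map_one]
    | gen_mul i x ih =>
      rw [map_mul, map_mul, ih, map_mul]
      exact congrArg (· * _) (hπ i)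
  have hΔ (n : ℕ) : (Δ ^ n).rev = Δ ^ n := by rw [CoxeterMatrix.ArtinMonoid.rev_pow, cs.rev_garside]
  have hπ_rev (x) : π (rev x) = (π x)⁻¹ := by
    obtain ⟨n, b, h⟩ := cs.exists_garside_pow_mul_eq x
    have hx : x = (ι (Δ ^ n))⁻¹ * ι b := eq_inv_mul_of_mul_eq h
    rw [hx, hmul, hrev_inv, hrev_ι, hrev_ι, map_mul, map_mul, map_inv, map_inv, hπ_ι, hπ_ι, hπ_ι,
      hπ_ι, cs.ofArtinMonoid_rev, cs.ofArtinMonoid_rev]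
    group
  refine ⟨fun x y hxy => ?_, Set.ext fun x => ⟨?_, ?_⟩⟩
  · obtain ⟨n, b, h⟩ := cs.exists_garside_pow_mul_eq (y⁻¹ * x)
    have h1 : (y⁻¹ * x) * rev (y⁻¹ * x) = 1 := by
      have hxy' : x * rev x = y * rev y := hxy
      rw [hmul, hrev_inv, mul_assoc, ← mul_assoc x, hxy']
      group
    have h2 : b * b.rev = Δ ^ (2 * n) := by
      apply hι
      rw [map_mul, ← hrev_ι, ← h, hmul, hrev_ι, hΔ, mul_assoc, ← mul_assoc (y⁻¹ * x), h1, one_mul,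
        ← map_mul, two_mul, pow_add]
    have h3 := cs.eq_garside_pow_of_mul_rev h2
    rw [h3] at h
    exact (inv_mul_eq_one.1 (mul_eq_left.1 h)).symm
  · rintro ⟨y, rfl⟩
    exact ⟨by rw [map_mul, hπ_rev, mul_inv_cancel], by rw [hmul, hinv]⟩
  · rintro ⟨h1, h2⟩
    obtain ⟨n, b, h⟩ := cs.exists_garside_pow_mul_eq x
    have h3 : ι (b * Δ ^ n) = ι (Δ ^ n) * x * ι (Δ ^ n) := by rw [map_mul, ← h]
    obtain ⟨y, hy⟩ := cs.exists_eq_mul_rev (p := b * Δ ^ n)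
      (hι (by rw [← hrev_ι, h3, hmul, hmul, hrev_ι, hΔ, h2, mul_assoc]))
      (by
        rw [← hπ_ι, h3, map_mul, map_mul, h1, mul_one, ← map_mul, ← map_mul, hπ_ι]
        nth_rw 2 [← hΔ]
        rw [map_mul, cs.ofArtinMonoid_rev, mul_inv_cancel])
    refine ⟨(ι (Δ ^ n))⁻¹ * ι y, ?_⟩
    have h4 := congrArg ι hy
    rw [h3, map_mul, ← hrev_ι] at h4
    show (ι (Δ ^ n))⁻¹ * ι y * rev ((ι (Δ ^ n))⁻¹ * ι y) = x
    rw [hmul, hrev_inv, hrev_ι (Δ ^ n), hΔ, mul_assoc, ← mul_assoc (ι y), ← h4]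
    group
end

section
/- For every n ≥ 2, the braid group B n admits a left-invariant linear order < such that for all x ∈ B n, x > 1 if and only if rev x > 1. -/
/-- The braid relators on `n` strands: `σᵢσⱼσᵢ = σⱼσᵢσⱼ` when `|i−j| = 1` and
`σᵢσⱼ = σⱼσᵢ` when `|i−j| ≥ 2`. -/
def braidRels (n : ℕ) : Set (FreeGroup (Fin (n - 1))) :=
  { r | ∃ i j : Fin (n - 1),
      ((i : ℕ) + 1 = (j : ℕ) ∧
        r = (FreeGroup.of i * FreeGroup.of j * FreeGroup.of i) *
            (FreeGroup.of j * FreeGroup.of i * FreeGroup.of j)⁻¹) ∨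
      ((i : ℕ) + 2 ≤ (j : ℕ) ∧
        r = (FreeGroup.of i * FreeGroup.of j) * (FreeGroup.of j * FreeGroup.of i)⁻¹) }

/-- The braid group on `n` strands, as a presented group on `n - 1` generators. -/
def BraidGroup (n : ℕ) : Type := PresentedGroup (braidRels n)

instance (n : ℕ) : Group (BraidGroup n) := QuotientGroup.Quotient.group _

/-- The Artin generator `σ i` of the braid group (here `i : Fin (n-1)` corresponds to the
classical generator `σ_{i+1}`). -/
def braidGen {n : ℕ} (i : Fin (n - 1)) : BraidGroup n := PresentedGroup.of i

namespace BraidOrder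

/-- A sequence of group elements together with a sequence of points of a set acted on. Braids act
on these by Artin's formulas. -/
@[ext]
structure Marking (A X : Type*) where
  u : ℕ → A
  p : ℕ → X

namespace Marking

variable {A X : Type*} [Group A] [MulAction A X]

/-- The action of the `i`-th Artin generator. -/
def twist (i : ℕ) (D : Marking A X) : Marking A X where
  u j := if j = i then D.u i * D.u (i + 1) * (D.u i)⁻¹ else if j = i + 1 then D.u i else D.u j
  p j := if j = i then D.u i • D.p (i + 1) else if j = i + 1 then D.p i else D.p j

/-- The action of the inverse of the `i`-th Artin generator. -/
def untwist (i : ℕ) (D : Marking A X) : Marking A X where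
  u j := if j = i then D.u (i + 1) else
    if j = i + 1 then (D.u (i + 1))⁻¹ * D.u i * D.u (i + 1) else D.u j
  p j := if j = i then D.p (i + 1) else
    if j = i + 1 then (D.u (i + 1))⁻¹ • D.p i else D.p j

theorem twist_u (i j : ℕ) (D : Marking A X) : (D.twist i).u j =
    if j = i then D.u i * D.u (i + 1) * (D.u i)⁻¹ else if j = i + 1 then D.u i else D.u j := rfl

theorem twist_p (i j : ℕ) (D : Marking A X) : (D.twist i).p j =
    if j = i then D.u i • D.p (i + 1) else if j = i + 1 then D.p i else D.p j := rfl

theorem untwist_u (i j : ℕ) (D : Marking A X) : (D.untwist i).u j =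
    if j = i then D.u (i + 1) else
      if j = i + 1 then (D.u (i + 1))⁻¹ * D.u i * D.u (i + 1) else D.u j := rfl

theorem untwist_p (i j : ℕ) (D : Marking A X) : (D.untwist i).p j =
    if j = i then D.p (i + 1) else
      if j = i + 1 then (D.u (i + 1))⁻¹ • D.p i else D.p j := rfl

theorem untwist_twist (i : ℕ) (D : Marking A X) : (D.twist i).untwist i = D := by
  ext j <;> by_cases h : j = i <;> by_cases h' : j = i + 1 <;>
    simp [twist_u, twist_p, untwist_u, untwist_p, h, h', mul_assoc]

theorem twist_untwist (i : ℕ) (D : Marking A X) : (D.untwist i).twist i = D := by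
  ext j <;> by_cases h : j = i <;> by_cases h' : j = i + 1 <;>
    simp [twist_u, twist_p, untwist_u, untwist_p, h, h', mul_assoc]

/-- `twist` as a permutation. -/
def twistPerm (i : ℕ) : Equiv.Perm (Marking A X) :=
  ⟨twist i, untwist i, untwist_twist i, twist_untwist i⟩

theorem twist_braid (i : ℕ) (D : Marking A X) :
    ((D.twist i).twist (i + 1)).twist i = ((D.twist (i + 1)).twist i).twist (i + 1) := by
  have h1 : i + 1 + 1 ≠ i := by omega
  ext j <;> by_cases h : j = i <;> by_cases h' : j = i + 1 <;> by_cases h'' : j = i + 2 <;>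
    first | omega | simp [twist_u, twist_p, h, h', h'', h1, h1.symm, mul_assoc, mul_smul]

theorem twist_comm {i k : ℕ} (hik : i + 2 ≤ k) (D : Marking A X) :
    (D.twist i).twist k = (D.twist k).twist i := by
  have h1 : i ≠ k := by omega
  have h2 : i + 1 ≠ k := by omega
  have h3 : i ≠ k + 1 := by omega
  ext j <;> by_cases h : j = i <;> by_cases h' : j = i + 1 <;> by_cases h'' : j = k <;>
    by_cases h4 : j = k + 1 <;>
    first
    | omega
    | simp [twist_u, twist_p, h, h', h'', h4, h1, h2, h3, h1.symm, h2.symm, h3.symm]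

theorem lift_twistPerm_eq_one {n : ℕ} :
    ∀ r ∈ braidRels n, FreeGroup.lift
      (fun i : Fin (n - 1) => (twistPerm (i : ℕ) : Equiv.Perm (Marking A X))) r = 1 := by
  rintro r ⟨i, j, ⟨hij, rfl⟩ | ⟨hij, rfl⟩⟩
  · simp only [map_mul, map_inv, FreeGroup.lift_apply_of, mul_inv_eq_one, ← hij]
    ext1 D
    exact twist_braid (i : ℕ) D
  · simp only [map_mul, map_inv, FreeGroup.lift_apply_of, mul_inv_eq_one]
    ext1 D
    exact (twist_comm hij D).symm

/-- The action of the braid group on markings, as a homomorphism. -/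
def braidHom (n : ℕ) (A X : Type*) [Group A] [MulAction A X] :
    BraidGroup n →* Equiv.Perm (Marking A X) :=
  PresentedGroup.toGroup lift_twistPerm_eq_one

instance (n : ℕ) : MulAction (BraidGroup n) (Marking A X) :=
  MulAction.compHom _ (braidHom n A X)

theorem braidGen_smul {n : ℕ} (i : Fin (n - 1)) (D : Marking A X) :
    braidGen i • D = D.twist i :=
  congrArg (fun e : Equiv.Perm (Marking A X) => e D)
    (PresentedGroup.toGroup.of lift_twistPerm_eq_one)

theorem braidGen_inv_smul {n : ℕ} (i : Fin (n - 1)) (D : Marking A X) :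
    (braidGen i)⁻¹ • D = D.untwist i := by
  rw [inv_smul_eq_iff, braidGen_smul, twist_untwist]

end Marking

theorem closure_range_braidGen (n : ℕ) :
    Subgroup.closure (Set.range (braidGen : Fin (n - 1) → BraidGroup n)) = ⊤ :=
  PresentedGroup.closure_range_of (braidRels n)

theorem braid_induction {n : ℕ} {P : BraidGroup n → Prop} (one : P 1)
    (gen : ∀ i g, P g → P (braidGen i * g)) (inv : ∀ i g, P g → P ((braidGen i)⁻¹ * g))
    (g : BraidGroup n) : P g := by
  have hg : g ∈ Subgroup.closure (Set.range (braidGen : Fin (n - 1) → BraidGroup n)) := by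
    rw [closure_range_braidGen]; trivial
  induction hg using Subgroup.closure_induction_left with
  | one => exact one
  | mul_left x hx y _ ih => obtain ⟨i, rfl⟩ := hx; exact gen i y ih
  | inv_mul_cancel x hx y _ ih => obtain ⟨i, rfl⟩ := hx; exact inv i y ih

namespace Marking

variable {A X B Y : Type*} [Group A] [MulAction A X] [Group B] [MulAction B Y] {n : ℕ}

/-- Functoriality of markings. -/
def map (f : A → B) (e : X → Y) (D : Marking A X) : Marking B Y :=
  ⟨fun i => f (D.u i), fun i => e (D.p i)⟩

theorem map_smul (f : A →* B) (e : X → Y) (he : ∀ a x, e (a • x) = f a • e x)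
    (g : BraidGroup n) (D : Marking A X) : (g • D).map f e = g • D.map f e := by
  induction g using braid_induction with
  | one => simp
  | gen i g ih =>
    rw [mul_smul, mul_smul, ← ih, braidGen_smul, braidGen_smul]
    ext j <;> simp only [map, twist] <;> split_ifs <;> simp [he]
  | inv i g ih =>
    rw [mul_smul, mul_smul, ← ih, braidGen_inv_smul, braidGen_inv_smul]
    ext j <;> simp only [map, untwist] <;> split_ifs <;> simp [he]

/-- If the group entries are equivariant functions of the point entries, this persists. -/
theorem smul_u_eq (c : X → A) (hc : ∀ a x, c (a • x) = a * c x * a⁻¹) (g : BraidGroup n)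
    (D : Marking A X) (hD : ∀ i, D.u i = c (D.p i)) (i : ℕ) : (g • D).u i = c ((g • D).p i) := by
  induction g using braid_induction generalizing i with
  | one => simpa using hD i
  | gen k g ih =>
    rw [mul_smul, braidGen_smul]
    simp only [twist]
    split_ifs <;> simp [hc, ih]
  | inv k g ih =>
    rw [mul_smul, braidGen_inv_smul]
    simp only [untwist]
    split_ifs <;> simp [hc, ih]

end Marking

/-- The free `A`-set on `ℕ`. -/
abbrev Label (A : Type*) := Σ _ : ℕ, A

/-- The universal marking. -/
def univ : Marking (FreeGroup ℕ) (Label (FreeGroup ℕ)) := ⟨FreeGroup.of, fun i => ⟨i, 1⟩⟩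

namespace Marking

variable {A X : Type*} [Group A] [MulAction A X] {n : ℕ}

/-- Evaluation of universal labels at a marking. -/
def eval (D : Marking A X) (l : Label (FreeGroup ℕ)) : X := FreeGroup.lift D.u l.2 • D.p l.1

theorem univ_map (D : Marking A X) : univ.map (FreeGroup.lift D.u) D.eval = D := by
  ext i <;> simp [univ, map, eval]

theorem smul_univ_map (g : BraidGroup n) (D : Marking A X) :
    (g • univ).map (FreeGroup.lift D.u) D.eval = g • D := by
  rw [map_smul _ _ _ g, univ_map]
  rintro a ⟨j, w⟩
  simp [eval, mul_smul, Sigma.smul_mk]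

theorem smul_p (g : BraidGroup n) (D : Marking A X) (i : ℕ) :
    (g • D).p i = D.eval ((g • univ).p i) := by
  rw [← smul_univ_map]; rfl

theorem smul_u (g : BraidGroup n) (D : Marking A X) (i : ℕ) :
    (g • D).u i = FreeGroup.lift D.u ((g • univ).u i) := by
  rw [← smul_univ_map]; rfl

theorem smul_univ_u (g : BraidGroup n) (i : ℕ) : (g • univ).u i =
    ((g • univ).p i).2 * FreeGroup.of ((g • univ).p i).1 * ((g • univ).p i).2⁻¹ :=
  smul_u_eq (fun l : Label (FreeGroup ℕ) => l.2 * FreeGroup.of l.1 * l.2⁻¹)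
    (by rintro a ⟨j, w⟩; simp [Sigma.smul_mk, mul_assoc]) g univ (by simp [univ]) i

/-- `g` fixes the `i`-th point of every marking. -/
theorem smul_p_of_trivial {g : BraidGroup n} {i : ℕ} (h : (g • univ).p i = ⟨i, 1⟩)
    (D : Marking A X) : (g • D).p i = D.p i := by
  rw [smul_p, h]; simp [eval]

theorem smul_u_of_trivial {g : BraidGroup n} {i : ℕ} (h : (g • univ).p i = ⟨i, 1⟩)
    (D : Marking A X) : (g • D).u i = D.u i := by
  rw [smul_u, smul_univ_u, h]; simp

/-- The product of the first `i` group entries. -/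
def prefixProd (D : Marking A X) : ℕ → A
  | 0 => 1
  | i + 1 => prefixProd D i * D.u i

/-- The mirror image of a marking. -/
def mirror (D : Marking A X) : Marking A X where
  u i := D.prefixProd i * (D.u i)⁻¹ * (D.prefixProd i)⁻¹
  p i := D.prefixProd i • D.p i

theorem prefixProd_congr {A X : Type*} [Group A] {D E : Marking A X} {j : ℕ} (h : ∀ k < j, D.u k = E.u k) :
    D.prefixProd j = E.prefixProd j := by
  induction j with
  | zero => rfl
  | succ j ih => rw [prefixProd, prefixProd, ih fun k hk => h k (by omega), h j (by omega)]

theorem prefixProd_twist_of_le {D : Marking A X} {i j : ℕ} (h : j ≤ i) :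
    (D.twist i).prefixProd j = D.prefixProd j := by
  refine prefixProd_congr fun k hk => ?_
  have h1 : k ≠ i := by omega
  have h2 : k ≠ i + 1 := by omega
  simp [twist_u, h1, h2]

theorem prefixProd_twist_of_lt {D : Marking A X} {i j : ℕ} (h : i + 2 ≤ j) :
    (D.twist i).prefixProd j = D.prefixProd j := by
  induction j, h using Nat.le_induction with
  | base => simp [prefixProd, prefixProd_twist_of_le le_rfl, twist_u, mul_assoc]
  | succ j hj ih =>
    have h1 : j ≠ i := by omega
    have h2 : j ≠ i + 1 := by omega
    simp [prefixProd, ih, twist_u, h1, h2]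

theorem mirror_u (D : Marking A X) (i : ℕ) :
    D.mirror.u i = D.prefixProd i * (D.u i)⁻¹ * (D.prefixProd i)⁻¹ := rfl

theorem mirror_p (D : Marking A X) (i : ℕ) : D.mirror.p i = D.prefixProd i • D.p i := rfl

theorem mirror_twist (i : ℕ) (D : Marking A X) : (D.twist i).mirror = D.mirror.untwist i := by
  have e1 : (D.twist i).prefixProd (i + 1) = D.prefixProd i * (D.u i * D.u (i + 1) * (D.u i)⁻¹) := by
    rw [prefixProd, prefixProd_twist_of_le le_rfl]; simp [twist_u]
  have e2 : D.prefixProd (i + 1) = D.prefixProd i * D.u i := rfl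
  ext j <;> rcases lt_trichotomy j i with h | rfl | h
  · have h2 : j ≠ i + 1 := by omega
    simp [mirror_u, untwist_u, prefixProd_twist_of_le h.le, twist_u, h.ne, h2]
  · simp [mirror_u, untwist_u, prefixProd_twist_of_le le_rfl, twist_u, e2, mul_assoc]
  · rcases (Nat.succ_le_of_lt h).eq_or_lt with rfl | h'
    · simp [mirror_u, untwist_u, e1, e2, twist_u, mul_assoc]
    · have h1 : j ≠ i := by omega
      have h2 : j ≠ i + 1 := by omega
      simp [mirror_u, untwist_u, prefixProd_twist_of_lt h', twist_u, h1, h2]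
  · have h2 : j ≠ i + 1 := by omega
    simp [mirror_p, untwist_p, prefixProd_twist_of_le h.le, twist_p, h.ne, h2]
  · simp [mirror_p, untwist_p, prefixProd_twist_of_le le_rfl, twist_p, e2, mul_smul]
  · rcases (Nat.succ_le_of_lt h).eq_or_lt with rfl | h'
    · simp [mirror_p, mirror_u, untwist_p, e1, e2, twist_p, mul_smul]
    · have h1 : j ≠ i := by omega
      have h2 : j ≠ i + 1 := by omega
      simp [mirror_p, untwist_p, prefixProd_twist_of_lt h', twist_p, h1, h2]

theorem mirror_untwist (i : ℕ) (D : Marking A X) : (D.untwist i).mirror = D.mirror.twist i := by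
  rw [← twist_untwist i (D.untwist i).mirror, ← mirror_twist, twist_untwist]

theorem rev_smul_mirror {rev : BraidGroup n → BraidGroup n}
    (hmul : ∀ x y, rev (x * y) = rev y * rev x) (hgen : ∀ i, rev (braidGen i) = braidGen i)
    (g : BraidGroup n) (D : Marking A X) : rev g • (g • D).mirror = D.mirror := by
  have h1 : rev 1 = 1 := by simpa using hmul 1 1
  have hinv : ∀ x, rev x⁻¹ = (rev x)⁻¹ := fun x => by
    rw [eq_inv_iff_mul_eq_one, ← hmul, mul_inv_cancel, h1]
  induction g using braid_induction with
  | one => simp [h1]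
  | gen i g ih =>
    rw [hmul, hgen, mul_smul, mul_smul, braidGen_smul, braidGen_smul, mirror_twist,
      twist_untwist, ih]
  | inv i g ih =>
    rw [hmul, hinv, hgen, mul_smul, mul_smul, braidGen_inv_smul, braidGen_inv_smul,
      mirror_untwist, untwist_twist, ih]

end Marking

/-- Monotonicity and incidence conditions under which `D` behaves like the generators of the
fundamental group of a punctured disc acting on its boundary at infinity: `D.u i` moves `D.p i`
back by the full turn `z`, and the points `q i` separate the points `D.p i`. -/
structure IsConfig {A L : Type*} [Group A] [LinearOrder L] [MulAction A L] (z : A)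
    (D : Marking A L) (q : ℕ → L) : Prop where
  mono (a : A) : StrictMono fun x : L => a • x
  comm (i : ℕ) : Commute z (D.u i)
  q_lt_p (i : ℕ) : q i < D.p i
  p_lt_q (i : ℕ) : D.p i < q (i + 1)
  q_lt_z (i : ℕ) : q i < z • q 0
  u_p (i : ℕ) : D.u i • D.p i = z⁻¹ • D.p i
  u_q (i : ℕ) : D.u i • q (i + 1) = q i

namespace IsConfig

open Marking

variable {A L : Type*} [Group A] [LinearOrder L] [MulAction A L] {z : A} {D : Marking A L}
  {q : ℕ → L} {n : ℕ}

theorem smul_lt (h : IsConfig z D q) {a : A} {x y : L} : a • x < a • y ↔ x < y :=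
  (h.mono a).lt_iff_lt

theorem smul_le (h : IsConfig z D q) {a : A} {x y : L} : a • x ≤ a • y ↔ x ≤ y :=
  (h.mono a).le_iff_le

theorem lt_inv_smul (h : IsConfig z D q) {a : A} {x y : L} : x < a⁻¹ • y ↔ a • x < y := by
  rw [← h.smul_lt (a := a), smul_inv_smul]

theorem inv_smul_lt (h : IsConfig z D q) {a : A} {x y : L} : a⁻¹ • x < y ↔ x < a • y := by
  rw [← h.smul_lt (a := a), smul_inv_smul]

theorem q_strictMono (h : IsConfig z D q) : StrictMono q :=
  strictMono_nat_of_lt_succ fun i => (h.q_lt_p i).trans (h.p_lt_q i)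

theorem p_strictMono (h : IsConfig z D q) : StrictMono D.p :=
  strictMono_nat_of_lt_succ fun i => (h.p_lt_q i).trans (h.q_lt_p (i + 1))

theorem p_lt_z (h : IsConfig z D q) (i : ℕ) : D.p i < z • q 0 :=
  (h.p_lt_q i).trans (h.q_lt_z (i + 1))

theorem q_zero_lt_p (h : IsConfig z D q) (i : ℕ) : q 0 < D.p i :=
  (h.q_strictMono.monotone i.zero_le).trans_lt (h.q_lt_p i)

theorem u_z (h : IsConfig z D q) (i : ℕ) (x : L) : D.u i • z • x = z • D.u i • x := by
  rw [smul_smul, smul_smul, (h.comm i).eq]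

theorem u_z_p (h : IsConfig z D q) (i : ℕ) : D.u i • z • D.p i = D.p i := by
  rw [h.u_z, h.u_p, smul_inv_smul]

protected theorem twist (h : IsConfig z D q) (i : ℕ) :
    IsConfig z (D.twist i) fun j => if j = i + 1 then D.u i • q (i + 2) else q j := by
  have lt : D.u i • q (i + 2) < D.p i := by
    rw [← h.u_z_p, h.smul_lt]
    exact (h.q_lt_z _).trans (h.smul_lt.2 (h.q_zero_lt_p i))
  refine ⟨h.mono, fun j => ?_, fun j => ?_, fun j => ?_, fun j => ?_, fun j => ?_, fun j => ?_⟩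
  · rw [twist_u]
    split_ifs
    · exact ((h.comm _).mul_right (h.comm _)).mul_right (h.comm _).inv_right
    · exact h.comm _
    · exact h.comm _
  · rw [twist_p]
    split_ifs with h1 h2 h2
    · omega
    · exact lt
    · rw [h2, ← h.u_q, h.smul_lt]
      exact h.q_lt_p _
    · exact h.q_lt_p _
  · rw [twist_p]
    split_ifs with h1 h2 h3 h4
    · exact h.smul_lt.2 (h.p_lt_q _)
    · omega
    · omega
    · rw [h3]; exact h.p_strictMono (by omega) |>.trans (h.p_lt_q _)
    · omega
    · exact h.p_lt_q _
  · rw [if_neg (by omega : ¬ 0 = i + 1)]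
    split_ifs
    · exact lt.trans (h.p_lt_z i)
    · exact h.q_lt_z _
  · rw [twist_u, twist_p]
    split_ifs
    · rw [mul_smul, inv_smul_smul, mul_smul, h.u_p, smul_smul, smul_smul,
        ((h.comm i).inv_left).eq]
    · exact h.u_p _
    · exact h.u_p _
  · rw [twist_u]
    split_ifs with h1 h2 h3 h4 h5 h6
    · omega
    · rw [mul_smul, inv_smul_smul, mul_smul, h.u_q, h.u_q, h1]
    · omega
    · omega
    · omega
    · rw [h5]
    · omega
    · exact h.u_q _

protected theorem untwist (h : IsConfig z D q) (i : ℕ) :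
    IsConfig z (D.untwist i) fun j => if j = i + 1 then (D.u (i + 1))⁻¹ • q i else q j := by
  have lt : (D.u (i + 1))⁻¹ • q i < q (i + 2) := by
    rw [h.inv_smul_lt, h.u_q]
    exact h.q_strictMono (Nat.lt_succ_self i)
  refine ⟨h.mono, fun j => ?_, fun j => ?_, fun j => ?_, fun j => ?_, fun j => ?_, fun j => ?_⟩
  · rw [untwist_u]
    split_ifs
    · exact h.comm _
    · exact ((h.comm _).inv_right.mul_right (h.comm _)).mul_right (h.comm _)
    · exact h.comm _
  · rw [untwist_p]
    split_ifs with h1 h2 h2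
    · omega
    · exact h.smul_lt.2 (h.q_lt_p i)
    · rw [h2]; exact h.q_strictMono (Nat.lt_succ_self i) |>.trans (h.q_lt_p _)
    · exact h.q_lt_p _
  · rw [untwist_p]
    split_ifs with h1 h2 h3 h4
    · rw [h.lt_inv_smul, h.u_p, h.inv_smul_lt]
      exact (h.p_lt_z _).trans_le (h.smul_le.2 (h.q_strictMono.monotone i.zero_le))
    · omega
    · omega
    · rw [h.inv_smul_lt, h3, h.u_q]; exact h.p_lt_q _
    · omega
    · exact h.p_lt_q _
  · rw [if_neg (by omega : ¬ 0 = i + 1)]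
    split_ifs
    · exact lt.trans (h.q_lt_z _)
    · exact h.q_lt_z _
  · rw [untwist_u, untwist_p]
    split_ifs
    · exact h.u_p _
    · rw [mul_smul, smul_inv_smul, mul_smul, h.u_p, smul_smul, smul_smul,
        (h.comm (i + 1)).inv_inv.eq]
    · exact h.u_p _
  · rw [untwist_u]
    split_ifs with h1 h2 h3 h4 h5 h6
    · omega
    · rw [smul_inv_smul, h1]
    · omega
    · omega
    · omega
    · rw [h5, mul_smul, h.u_q, mul_smul, h.u_q]
    · omega
    · exact h.u_q _

theorem exists_smul (h : IsConfig z D q) (g : BraidGroup n) : ∃ q', IsConfig z (g • D) q' := by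
  induction g using braid_induction with
  | one => exact ⟨q, by rwa [one_smul]⟩
  | gen i g ih =>
    obtain ⟨q', h'⟩ := ih
    rw [mul_smul, braidGen_smul]
    exact ⟨_, h'.twist i⟩
  | inv i g ih =>
    obtain ⟨q', h'⟩ := ih
    rw [mul_smul, braidGen_inv_smul]
    exact ⟨_, h'.untwist i⟩

theorem comm_prefixProd (h : IsConfig z D q) (i : ℕ) : Commute z (D.prefixProd i) := by
  induction i with
  | zero => exact Commute.one_right z
  | succ i ih => exact ih.mul_right (h.comm i)

theorem prefixProd_smul_q (h : IsConfig z D q) (i : ℕ) : D.prefixProd i • q i = q 0 := by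
  induction i with
  | zero => exact one_smul _ _
  | succ i ih => rw [prefixProd, mul_smul, h.u_q, ih]

theorem mirror (h : IsConfig z D q) :
    IsConfig z⁻¹ (D.mirror.map id OrderDual.toDual)
      fun i => OrderDual.toDual (z • D.prefixProd i • q 0) := by
  have zv (i : ℕ) (x : L) : z • D.prefixProd i • x = D.prefixProd i • z • x := by
    rw [smul_smul, smul_smul, (h.comm_prefixProd i).eq]
  refine ⟨fun a x y hxy => ?_, fun i => ?_, fun i => ?_, fun i => ?_, fun i => ?_, fun i => ?_,
    fun i => ?_⟩
  · exact h.mono a hxy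
  · exact (((h.comm_prefixProd i).mul_right (h.comm i).inv_right).mul_right
      (h.comm_prefixProd i).inv_right).inv_left
  · change D.prefixProd i • D.p i < z • D.prefixProd i • q 0
    rw [zv, h.smul_lt]
    exact h.p_lt_z i
  · change z • (D.prefixProd i * D.u i) • q 0 < D.prefixProd i • D.p i
    rw [mul_smul, zv, h.smul_lt, ← h.u_z, ← h.u_z_p, h.smul_lt, h.smul_lt]
    exact h.q_zero_lt_p i
  · change z⁻¹ • z • (1 : A) • q 0 < z • D.prefixProd i • q 0
    rw [inv_smul_smul, one_smul, zv]
    nth_rw 1 [← h.prefixProd_smul_q i]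
    rw [h.smul_lt]
    exact h.q_lt_z i
  · change (D.prefixProd i * (D.u i)⁻¹ * (D.prefixProd i)⁻¹) • D.prefixProd i • D.p i =
      z⁻¹⁻¹ • D.prefixProd i • D.p i
    rw [mul_smul, inv_smul_smul, mul_smul, inv_inv, zv]
    congr 1
    rw [inv_smul_eq_iff, h.u_z_p]
  · change (D.prefixProd i * (D.u i)⁻¹ * (D.prefixProd i)⁻¹) • z •
      (D.prefixProd i * D.u i) • q 0 = z • D.prefixProd i • q 0
    rw [mul_smul (D.prefixProd i) (D.u i), zv, mul_smul, inv_smul_smul, mul_smul, ← h.u_z,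
      inv_smul_smul, zv]

end IsConfig

namespace IsConfig

open Marking

variable {A L : Type*} [Group A] [LinearOrder L] [MulAction A L] {z : A} {D : Marking A L}
  {q : ℕ → L}

theorem lt_zpow_smul (h : IsConfig z D q) {k : ℤ} (hk : 0 < k) {x y : L} (hx : x < z • q 0)
    (hy : q 0 < y) : x < z ^ k • y := by
  have le (k : ℕ) : z • q 0 ≤ z ^ (k + 1) • q 0 := by
    induction k with
    | zero => simp
    | succ k ih =>
      rw [pow_succ', mul_smul, h.smul_le]
      exact (h.q_lt_z 0).le.trans ih
  obtain ⟨k, rfl⟩ : ∃ l : ℕ, k = (l + 1 : ℕ) := ⟨k.toNat - 1, by omega⟩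
  rw [zpow_natCast]
  exact hx.trans_le ((le k).trans (h.smul_le.2 hy.le))

theorem zpow_u_zpow_p (h : IsConfig z D q) (i : ℕ) (k : ℤ) :
    z ^ k • D.u i ^ k • D.p i = D.p i := by
  rw [smul_smul, ← (h.comm i).mul_zpow]
  refine zpow_mem (K := MulAction.stabilizer A (D.p i)) ?_ k
  rw [MulAction.mem_stabilizer_iff, mul_smul, h.u_p, smul_inv_smul]

/-- The element of the group attached to a letter of a free group word. -/
def letter {A L : Type*} [Group A] (D : Marking A L) (a : ℕ × Bool) : A := cond a.2 (D.u a.1) (D.u a.1)⁻¹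

/-- The interval of points whose itinerary starts with a given letter. -/
def interval (D : Marking A L) (q : ℕ → L) (a : ℕ × Bool) : Set L :=
  cond a.2 (Set.Ioo (q a.1) (D.p a.1)) (Set.Ioo (D.p a.1) (q (a.1 + 1)))

theorem interval_subset (h : IsConfig z D q) {a : ℕ × Bool} {x : L} (hx : x ∈ interval D q a) :
    q a.1 < x ∧ x < q (a.1 + 1) := by
  obtain ⟨i, _ | _⟩ := a
  · exact ⟨(h.q_lt_p i).trans hx.1, hx.2⟩
  · exact ⟨hx.1, hx.2.trans (h.p_lt_q i)⟩

theorem q_zero_lt (h : IsConfig z D q) {i : ℕ} {x : L} (hx : q i < x) : q 0 < x :=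
  (h.q_strictMono.monotone i.zero_le).trans_lt hx

/-- The ways a point can lie to the left of the repelling end of a letter. -/
def IsLeft (D : Marking A L) (q : ℕ → L) (a : ℕ × Bool) (x : L) : Prop :=
  q 0 < x ∧ x < cond a.2 (D.p a.1) (q a.1)

/-- The ways a point can lie to the right of the repelling end of a letter. -/
def IsRight (z : A) (D : Marking A L) (q : ℕ → L) (a : ℕ × Bool) (x : L) : Prop :=
  cond a.2 (q (a.1 + 1)) (D.p a.1) < x ∧ x < z • q 0

theorem smul_mem_of_isLeft (h : IsConfig z D q) {a : ℕ × Bool} {x : L} (hx : IsLeft D q a x) :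
    z ^ cond a.2 (1 : ℤ) 0 • letter D a • x ∈ interval D q a := by
  obtain ⟨i, _ | _⟩ := a
  · obtain ⟨h0, h1⟩ := hx
    change x < q i at h1
    change z ^ (0 : ℤ) • (D.u i)⁻¹ • x ∈ Set.Ioo (D.p i) (q (i + 1))
    rw [zpow_zero, one_smul]
    refine ⟨?_, by rwa [h.inv_smul_lt, h.u_q]⟩
    rw [h.lt_inv_smul, h.u_p, h.inv_smul_lt]
    exact (h.p_lt_z i).trans (h.smul_lt.2 h0)
  · obtain ⟨h0, h1⟩ := hx
    change x < D.p i at h1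
    change z ^ (1 : ℤ) • D.u i • x ∈ Set.Ioo (q i) (D.p i)
    rw [zpow_one, ← h.u_z]
    refine ⟨?_, (h.smul_lt.2 (h.smul_lt.2 h1)).trans_eq (h.u_z_p i)⟩
    rw [← h.u_q, h.smul_lt]
    exact (h.q_lt_z _).trans (h.smul_lt.2 h0)

theorem smul_mem_of_isRight (h : IsConfig z D q) {a : ℕ × Bool} {x : L}
    (hx : IsRight z D q a x) :
    z ^ cond a.2 (0 : ℤ) (-1) • letter D a • x ∈ interval D q a := by
  obtain ⟨i, _ | _⟩ := a
  · obtain ⟨h1, h0⟩ := hx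
    change D.p i < x at h1
    change z ^ (-1 : ℤ) • (D.u i)⁻¹ • x ∈ Set.Ioo (D.p i) (q (i + 1))
    rw [zpow_neg_one]
    refine ⟨?_, ?_⟩
    · rwa [h.lt_inv_smul, h.lt_inv_smul, h.u_z_p]
    · rw [h.inv_smul_lt, h.inv_smul_lt, h.u_z, h.u_q]
      exact h0.trans_le (h.smul_le.2 (h.q_strictMono.monotone i.zero_le))
  · obtain ⟨h1, h0⟩ := hx
    change q (i + 1) < x at h1
    change z ^ (0 : ℤ) • D.u i • x ∈ Set.Ioo (q i) (D.p i)
    rw [zpow_zero, one_smul]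
    refine ⟨by rwa [← h.u_q, h.smul_lt], ?_⟩
    rw [← h.u_z_p, h.smul_lt]
    exact h0.trans (h.smul_lt.2 (h.q_zero_lt_p i))

theorem isLeft_of_lt (h : IsConfig z D q) {a : ℕ × Bool} {j : ℕ} (hj : j < a.1) {x : L}
    (h0 : q j < x) (h1 : x < q (j + 1)) : IsLeft D q a x := by
  have h2 : x < q a.1 := h1.trans_le (h.q_strictMono.monotone hj)
  obtain ⟨i, _ | _⟩ := a
  · exact ⟨h.q_zero_lt h0, h2⟩
  · exact ⟨h.q_zero_lt h0, h2.trans (h.q_lt_p i)⟩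

theorem isRight_of_lt (h : IsConfig z D q) {a : ℕ × Bool} {j : ℕ} (hj : a.1 < j) {x : L}
    (h0 : q j < x) (h1 : x < q (j + 1)) : IsRight z D q a x := by
  have h2 : q (a.1 + 1) < x := (h.q_strictMono.monotone hj).trans_lt h0
  obtain ⟨i, _ | _⟩ := a
  · exact ⟨(h.p_lt_q i).trans h2, h1.trans (h.q_lt_z _)⟩
  · exact ⟨h2, h1.trans (h.q_lt_z _)⟩

theorem lift_mk_cons {A L : Type*} [Group A] (D : Marking A L) (a : ℕ × Bool) (w : List (ℕ × Bool)) :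
    FreeGroup.lift D.u (FreeGroup.mk (a :: w)) = letter D a * FreeGroup.lift D.u (.mk w) := by
  simp [FreeGroup.lift_mk, letter]

theorem zpow_add_smul_letter (h : IsConfig z D q) (a : ℕ × Bool) (k m : ℤ) (x : L) :
    z ^ (k + m) • letter D a • x = z ^ k • letter D a • z ^ m • x := by
  have : Commute z (letter D a) := by
    obtain ⟨i, _ | _⟩ := a
    · exact (h.comm i).inv_right
    · exact h.comm i
  rw [zpow_add, mul_smul, smul_smul (z ^ m), (this.zpow_left m).eq, mul_smul]

end IsConfig

open Marking IsConfig

/-- Either the point labelled by a reduced word is a translate of a marked point, or its position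
is determined by the first letter of the word, up to a number of full turns that is the same for
all configurations. -/
theorem exists_zpow_or_mem_interval (j : ℕ) (w : List (ℕ × Bool)) (hw : FreeGroup.IsReduced w) :
    (∃ k : ℤ, FreeGroup.mk w = FreeGroup.of j ^ k) ∨
      ∃ (m : ℤ) (a : ℕ × Bool), w.head? = some a ∧
        ∀ (A L : Type) [Group A] [LinearOrder L] [MulAction A L] (z : A) (D : Marking A L)
          (q : ℕ → L), IsConfig z D q →
            z ^ m • FreeGroup.lift D.u (.mk w) • D.p j ∈ interval D q a := by
  induction w with
  | nil => exact .inl ⟨0, rfl⟩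
  | cons a w ih =>
    have hcons : FreeGroup.mk (a :: w) =
        cond a.2 (FreeGroup.of a.1) (FreeGroup.of a.1)⁻¹ * FreeGroup.mk w := by
      obtain ⟨i, _ | _⟩ := a <;> rfl
    rcases ih (List.IsChain.tail hw) with ⟨k, hk⟩ | ⟨m, a', ha', hm⟩
    · rcases lt_trichotomy j a.1 with hj | rfl | hj
      · refine .inr ⟨cond a.2 1 0 + k, a, rfl, fun A L _ _ _ z D q h => ?_⟩
        rw [lift_mk_cons, mul_smul, h.zpow_add_smul_letter, hk, map_zpow, FreeGroup.lift_apply_of,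
          h.zpow_u_zpow_p]
        exact h.smul_mem_of_isLeft (h.isLeft_of_lt hj (h.q_lt_p j) (h.p_lt_q j))
      · rw [hcons, hk]
        rcases a.2
        · exact .inl ⟨-1 + k, by simp [zpow_add]⟩
        · exact .inl ⟨1 + k, by simp [zpow_add]⟩
      · refine .inr ⟨cond a.2 0 (-1) + k, a, rfl, fun A L _ _ _ z D q h => ?_⟩
        rw [lift_mk_cons, mul_smul, h.zpow_add_smul_letter, hk, map_zpow, FreeGroup.lift_apply_of,
          h.zpow_u_zpow_p]
        exact h.smul_mem_of_isRight (h.isRight_of_lt hj (h.q_lt_p j) (h.p_lt_q j))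
    · have hred : a.1 = a'.1 → a.2 = a'.2 := by
        obtain ⟨w', rfl⟩ : ∃ w', w = a' :: w' := by
          cases w with
          | nil => simp at ha'
          | cons b w' => exact ⟨w', by simpa using ha'⟩
        exact (FreeGroup.isReduced_cons_cons.1 hw).1
      have key : (∀ (A L : Type) [Group A] [LinearOrder L] [MulAction A L] (z : A)
            (D : Marking A L) (q : ℕ → L), IsConfig z D q → ∀ x ∈ interval D q a',
            IsLeft D q a x) ∨
          ∀ (A L : Type) [Group A] [LinearOrder L] [MulAction A L] (z : A)
            (D : Marking A L) (q : ℕ → L), IsConfig z D q → ∀ x ∈ interval D q a',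
            IsRight z D q a x := by
        rcases lt_trichotomy a'.1 a.1 with hj | hj | hj
        · exact .inl fun A L _ _ _ z D q h x hx =>
            h.isLeft_of_lt hj (h.interval_subset hx).1 (h.interval_subset hx).2
        · obtain rfl : a' = a := Prod.ext hj (hred hj.symm).symm
          obtain ⟨i, _ | _⟩ := a'
          · exact .inr fun A L _ _ _ z D q h x hx => ⟨hx.1, hx.2.trans (h.q_lt_z _)⟩
          · exact .inl fun A L _ _ _ z D q h x hx => ⟨h.q_zero_lt hx.1, hx.2⟩
        · exact .inr fun A L _ _ _ z D q h x hx =>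
            h.isRight_of_lt hj (h.interval_subset hx).1 (h.interval_subset hx).2
      rcases key with hl | hr
      · refine .inr ⟨cond a.2 1 0 + m, a, rfl, fun A L _ _ _ z D q h => ?_⟩
        rw [lift_mk_cons, mul_smul, h.zpow_add_smul_letter]
        exact h.smul_mem_of_isLeft (hl A L z D q h _ (hm A L z D q h))
      · refine .inr ⟨cond a.2 0 (-1) + m, a, rfl, fun A L _ _ _ z D q h => ?_⟩
        rw [lift_mk_cons, mul_smul, h.zpow_add_smul_letter]
        exact h.smul_mem_of_isRight (hr A L z D q h _ (hm A L z D q h))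

/-- The label `l` lies to the left of the `i`-th marked point in every configuration. -/
def Below (l : Label (FreeGroup ℕ)) (i : ℕ) : Prop :=
  ∀ (A L : Type) [Group A] [LinearOrder L] [MulAction A L] (z : A) (D : Marking A L) (q : ℕ → L),
    IsConfig z D q → D.eval l < D.p i

/-- The label `l` lies to the right of the `i`-th marked point in every configuration. -/
def Above (l : Label (FreeGroup ℕ)) (i : ℕ) : Prop :=
  ∀ (A L : Type) [Group A] [LinearOrder L] [MulAction A L] (z : A) (D : Marking A L) (q : ℕ → L),
    IsConfig z D q → D.p i < D.eval l

theorem eq_or_below_or_above (l : Label (FreeGroup ℕ)) (i : ℕ) :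
    l = ⟨i, 1⟩ ∨ Below l i ∨ Above l i := by
  obtain ⟨j, w⟩ := l
  rcases exists_zpow_or_mem_interval j w.toWord FreeGroup.isReduced_toWord with
    ⟨k, hk⟩ | ⟨m, a, -, hm⟩
  · rw [FreeGroup.mk_toWord] at hk
    subst hk
    have eval (A L : Type) [Group A] [LinearOrder L] [MulAction A L] (z : A) (D : Marking A L)
        (q : ℕ → L) (h : IsConfig z D q) : D.eval ⟨j, .of j ^ k⟩ = z ^ (-k) • D.p j := by
      rw [zpow_neg, eq_inv_smul_iff, Marking.eval, map_zpow, FreeGroup.lift_apply_of,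
        h.zpow_u_zpow_p]
    rcases lt_trichotomy k 0 with hk | rfl | hk
    · refine .inr (.inr fun A L _ _ _ z D q h => ?_)
      rw [eval A L z D q h]
      exact h.lt_zpow_smul (by omega) (h.p_lt_z i) (h.q_zero_lt_p j)
    · rcases lt_trichotomy j i with hj | rfl | hj
      · refine .inr (.inl fun A L _ _ _ z D q h => ?_)
        rw [eval A L z D q h, neg_zero, zpow_zero, one_smul]
        exact h.p_strictMono hj
      · exact .inl rfl
      · refine .inr (.inr fun A L _ _ _ z D q h => ?_)
        rw [eval A L z D q h, neg_zero, zpow_zero, one_smul]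
        exact h.p_strictMono hj
    · refine .inr (.inl fun A L _ _ _ z D q h => ?_)
      rw [eval A L z D q h, zpow_neg, h.inv_smul_lt]
      exact h.lt_zpow_smul hk (h.p_lt_z j) (h.q_zero_lt_p i)
  · rw [FreeGroup.mk_toWord] at hm
    right
    rcases lt_trichotomy m 0 with hm0 | rfl | hm0
    · refine .inr fun A L _ _ _ z D q h => ?_
      obtain ⟨m, rfl⟩ : ∃ k, m = -k := ⟨-m, by simp⟩
      have hx := h.q_zero_lt (h.interval_subset (hm A L z D q h)).1
      have := h.lt_zpow_smul (k := m) (by omega) (h.p_lt_z i) hx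
      rwa [zpow_neg, smul_inv_smul] at this
    · simp only [zpow_zero, one_smul] at hm
      rcases lt_trichotomy a.1 i with hj | rfl | hj
      · exact .inl fun A L _ _ _ z D q h => ((h.interval_subset (hm A L z D q h)).2.trans_le
          (h.q_strictMono.monotone hj)).trans (h.q_lt_p i)
      · obtain ⟨i, _ | _⟩ := a
        · exact .inr fun A L _ _ _ z D q h => (hm A L z D q h).1
        · exact .inl fun A L _ _ _ z D q h => (hm A L z D q h).2
      · exact .inr fun A L _ _ _ z D q h => (h.p_lt_q i).trans
          ((h.q_strictMono.monotone hj).trans_lt (h.interval_subset (hm A L z D q h)).1)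
    · refine .inl fun A L _ _ _ z D q h => ?_
      have hx := h.interval_subset (hm A L z D q h)
      have := h.lt_zpow_smul hm0 (hx.2.trans (h.q_lt_z _)) (h.q_zero_lt_p i)
      exact h.smul_lt.1 this

section Coset

variable {G : Type*} [Group G]

/-- Coset representatives for the subgroup of braids fixing the first strand. -/
def coset (s : ℕ → G) : ℕ → G
  | 0 => 1
  | j + 1 => coset s j * (s j)⁻¹

/-- The pure braid in which the first strand goes once around the `t + 1`-st one. -/
def loop (s : ℕ → G) (t : ℕ) : G := coset s t * (s t * s t) * (coset s t)⁻¹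

/-- The braid relations, for the first `m` members of a sequence. -/
structure IsBraided (s : ℕ → G) (m : ℕ) : Prop where
  comm (i j : ℕ) : i + 2 ≤ j → Commute (s i) (s j)
  braid (i : ℕ) : i + 1 < m → s i * s (i + 1) * s i = s (i + 1) * s i * s (i + 1)

namespace IsBraided

variable {s : ℕ → G} {m : ℕ}

theorem coset_comm (h : IsBraided s m) {i j : ℕ} (hij : j < i) : Commute (coset s j) (s i) := by
  induction j with
  | zero => exact Commute.one_left _
  | succ j ih => exact (ih (by omega)).mul_left (h.comm j i (by omega)).inv_left

theorem coset_mul_of_lt (h : IsBraided s m) {i j : ℕ} (hij : i + 2 ≤ j) (hj : j ≤ m) :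
    coset s j * s i = s (i + 1) * coset s j := by
  induction j, hij using Nat.le_induction with
  | base =>
    have hb : (s i)⁻¹ * (s (i + 1))⁻¹ * s i = s (i + 1) * (s i)⁻¹ * (s (i + 1))⁻¹ := by
      rw [eq_mul_inv_iff_mul_eq, eq_mul_inv_iff_mul_eq]
      simp only [mul_assoc, inv_mul_eq_iff_eq_mul]
      simpa only [mul_assoc] using h.braid i (by omega)
    calc coset s i * (s i)⁻¹ * (s (i + 1))⁻¹ * s i
        = coset s i * ((s i)⁻¹ * (s (i + 1))⁻¹ * s i) := by group
      _ = coset s i * s (i + 1) * (s i)⁻¹ * (s (i + 1))⁻¹ := by rw [hb]; group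
      _ = s (i + 1) * (coset s i * (s i)⁻¹ * (s (i + 1))⁻¹) := by
        rw [(h.coset_comm (Nat.lt_succ_self i)).eq]; group
  | succ j hij ih =>
    rw [coset, mul_assoc, (h.comm i j hij).inv_right.symm.eq, ← mul_assoc, ih (by omega), mul_assoc]

theorem loop_succ (h : IsBraided s m) {t : ℕ} (ht : t + 1 < m) :
    loop s (t + 1) = s (t + 1) * loop s t * (s (t + 1))⁻¹ := by
  have hb : (s t)⁻¹ * s (t + 1) * s t = s (t + 1) * s t * (s (t + 1))⁻¹ := by
    rw [eq_mul_inv_iff_mul_eq, mul_assoc, mul_assoc, inv_mul_eq_iff_eq_mul]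
    simpa only [mul_assoc] using (h.braid t ht).symm
  have hc := h.coset_comm (Nat.lt_succ_self t)
  calc loop s (t + 1)
      = coset s t * (((s t)⁻¹ * s (t + 1) * s t) * ((s t)⁻¹ * s (t + 1) * s t)) *
        (coset s t)⁻¹ := by simp only [loop, coset]; group
    _ = (coset s t * s (t + 1)) * (s t * s t) * (coset s t * s (t + 1))⁻¹ := by rw [hb]; group
    _ = _ := by rw [hc.eq, loop]; group

theorem loop_mul_loop (h : IsBraided s m) {t : ℕ} (ht : t + 1 < m) :
    loop s t * s (t + 1) * loop s t * s (t + 1) = s (t + 1) * loop s t * s (t + 1) * loop s t := by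
  have hc := h.coset_comm (Nat.lt_succ_self t)
  have hb := h.braid t ht
  have e : loop s t * s (t + 1) =
      coset s t * (s t * s t * s (t + 1)) * (coset s t)⁻¹ := by
    rw [loop, mul_assoc, hc.inv_left.eq]; group
  have e' : s (t + 1) * loop s t =
      coset s t * (s (t + 1) * (s t * s t)) * (coset s t)⁻¹ := by
    rw [loop, ← mul_assoc, ← mul_assoc, ← hc.eq]; group
  have key : s t * s t * s (t + 1) * (s t * s t * s (t + 1)) =
      s (t + 1) * (s t * s t) * (s (t + 1) * (s t * s t)) := by
    calc _ = s t * (s t * s (t + 1) * s t) * s t * s (t + 1) := by group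
      _ = s t * (s (t + 1) * s t * s (t + 1)) * s t * s (t + 1) := by rw [hb]
      _ = (s t * s (t + 1) * s t) * (s (t + 1) * s t * s (t + 1)) := by group
      _ = (s (t + 1) * s t * s (t + 1)) * (s t * s (t + 1) * s t) := by rw [hb]
      _ = s (t + 1) * s t * (s (t + 1) * s t * s (t + 1)) * s t := by group
      _ = _ := by rw [← hb]; group
  calc _ = (loop s t * s (t + 1)) * (loop s t * s (t + 1)) := by group
    _ = coset s t * (s t * s t * s (t + 1) * (s t * s t * s (t + 1))) * (coset s t)⁻¹ := by
      rw [e]; group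
    _ = (s (t + 1) * loop s t) * (s (t + 1) * loop s t) := by rw [key, e']; group
    _ = _ := by group

theorem loop_comm (h : IsBraided s m) {i t : ℕ} (ht : t < m) (hi : 0 < i) (h1 : i ≠ t)
    (h2 : i ≠ t + 1) : Commute (s i) (loop s t) := by
  rcases lt_or_gt_of_ne h1 with h3 | h3
  · obtain ⟨i, rfl⟩ : ∃ l, i = l + 1 := ⟨i - 1, by omega⟩
    have e := h.coset_mul_of_lt (i := i) (j := t) (by omega) (by omega)
    have e' : s (i + 1) = coset s t * s i * (coset s t)⁻¹ := by rw [e]; group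
    have c := h.comm i t (by omega)
    rw [e', loop]
    exact (SemiconjBy.conj_iff).2 (c.mul_right c)
  · have c := h.coset_comm h3
    have c' := h.comm t i (by omega)
    exact (((c.mul_left (c'.mul_left c')).mul_left c.inv_left)).symm

theorem loop_conj_mem (h : IsBraided s m) {i t : ℕ} (hi : 0 < i) (him : i < m) (ht : t < m) :
    s i * loop s t * (s i)⁻¹ ∈ Subgroup.closure (loop s '' Set.Iio m) ∧
      (s i)⁻¹ * loop s t * s i ∈ Subgroup.closure (loop s '' Set.Iio m) := by
  have mem {l : ℕ} (hl : l < m) : loop s l ∈ Subgroup.closure (loop s '' Set.Iio m) :=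
    Subgroup.subset_closure ⟨l, hl, rfl⟩
  by_cases h1 : i = t
  · obtain ⟨t, rfl⟩ : ∃ l, t = l + 1 := ⟨t - 1, by omega⟩
    subst h1
    have a := mem (l := t) (by omega)
    have b := mem ht
    have e : s (t + 1) * loop s (t + 1) * (s (t + 1))⁻¹ =
        (loop s (t + 1))⁻¹ * loop s t * loop s (t + 1) := by
      have hl := h.loop_mul_loop ht
      rw [h.loop_succ ht]
      have e1 : s (t + 1) * loop s t * (s (t + 1))⁻¹ =
          (loop s t)⁻¹ * (s (t + 1))⁻¹ * loop s t * s (t + 1) * loop s t := by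
        rw [mul_inv_eq_iff_eq_mul]
        simp only [mul_assoc] at hl ⊢
        rw [hl]; group
      calc _ = s (t + 1) * (s (t + 1) * loop s t * (s (t + 1))⁻¹) * (s (t + 1))⁻¹ := by group
        _ = s (t + 1) * ((loop s t)⁻¹ * (s (t + 1))⁻¹ * loop s t * s (t + 1) * loop s t) *
            (s (t + 1))⁻¹ := by rw [e1]
        _ = _ := by group
    constructor
    · rw [e]; exact mul_mem (mul_mem (inv_mem b) a) b
    · rw [h.loop_succ ht]
      convert a using 1
      group
  by_cases h2 : i = t + 1
  · subst h2
    have a := mem ht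
    have b := mem him
    constructor
    · rwa [← h.loop_succ him]
    · have e : (s (t + 1))⁻¹ * loop s t * s (t + 1) =
          loop s t * loop s (t + 1) * (loop s t)⁻¹ := by
        have hl := h.loop_mul_loop him
        rw [h.loop_succ him, eq_mul_inv_iff_mul_eq, ← mul_assoc, ← mul_assoc,
          eq_mul_inv_iff_mul_eq]
        simp only [mul_assoc] at hl ⊢
        rw [hl]; group
      rw [e]
      exact mul_mem (mul_mem a b) (inv_mem a)
  · have c := h.loop_comm ht hi h1 h2
    have a := mem ht
    constructor
    · rwa [c.eq, mul_inv_cancel_right]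
    · rwa [mul_assoc, ← c.eq, inv_mul_cancel_left]

theorem conj_mem (h : IsBraided s m) {x f : G} (hx : x ∈ Subgroup.closure (s '' Set.Ico 1 m))
    (hf : f ∈ Subgroup.closure (loop s '' Set.Iio m)) :
    x⁻¹ * f * x ∈ Subgroup.closure (loop s '' Set.Iio m) := by
  induction hx using Subgroup.closure_induction_left generalizing f with
  | one => simpa using hf
  | mul_left y hy x _ ih =>
    obtain ⟨i, ⟨h1, hm⟩, rfl⟩ := hy
    have : f ∈ (Subgroup.closure (loop s '' Set.Iio m)).comap (MulAut.conj (s i)⁻¹).toMonoidHom := by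
      refine (Subgroup.closure_le _).2 ?_ hf
      rintro _ ⟨t, ht, rfl⟩
      simpa using (h.loop_conj_mem h1 hm ht).2
    have := ih this
    simpa [mul_assoc] using this
  | inv_mul_cancel y hy x _ ih =>
    obtain ⟨i, ⟨h1, hm⟩, rfl⟩ := hy
    have : f ∈ (Subgroup.closure (loop s '' Set.Iio m)).comap (MulAut.conj (s i)).toMonoidHom := by
      refine (Subgroup.closure_le _).2 ?_ hf
      rintro _ ⟨t, ht, rfl⟩
      simpa using (h.loop_conj_mem h1 hm ht).1
    have := ih this
    simpa [mul_assoc] using this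

/-- Artin's combing of braids. -/
theorem exists_eq_mul_mul_coset (h : IsBraided s m) {g : G}
    (hg : g ∈ Subgroup.closure (s '' Set.Iio m)) :
    ∃ x ∈ Subgroup.closure (s '' Set.Ico 1 m), ∃ f ∈ Subgroup.closure (loop s '' Set.Iio m),
      ∃ j ≤ m, g = x * f * coset s j := by
  have memH {i : ℕ} (h0 : 1 ≤ i) (hi : i < m) : s i ∈ Subgroup.closure (s '' Set.Ico 1 m) :=
    Subgroup.subset_closure ⟨i, ⟨h0, hi⟩, rfl⟩
  have memF {i : ℕ} (hi : i < m) : loop s i ∈ Subgroup.closure (loop s '' Set.Iio m) :=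
    Subgroup.subset_closure ⟨i, hi, rfl⟩
  have extend {x f y : G} {j : ℕ} (hx : x ∈ Subgroup.closure (s '' Set.Ico 1 m))
      (hf : f ∈ Subgroup.closure (loop s '' Set.Iio m))
      (hy : ∃ x' ∈ Subgroup.closure (s '' Set.Ico 1 m),
        ∃ f' ∈ Subgroup.closure (loop s '' Set.Iio m), ∃ j' ≤ m,
          coset s j * y = x' * f' * coset s j') :
      ∃ x' ∈ Subgroup.closure (s '' Set.Ico 1 m),
        ∃ f' ∈ Subgroup.closure (loop s '' Set.Iio m), ∃ j' ≤ m,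
          x * f * coset s j * y = x' * f' * coset s j' := by
    obtain ⟨x', hx', f', hf', j', hj', e⟩ := hy
    refine ⟨x * x', mul_mem hx hx', x'⁻¹ * f * x' * f', mul_mem (h.conj_mem hx' hf) hf', j', hj', ?_⟩
    rw [mul_assoc, e]; group
  induction hg using Subgroup.closure_induction_right with
  | one => exact ⟨1, one_mem _, 1, one_mem _, 0, m.zero_le, by simp [coset]⟩
  | mul_right g _ y hy ih =>
    obtain ⟨i, hi, rfl⟩ := hy
    obtain ⟨x, hx, f, hf, j, hj, rfl⟩ := ih
    refine extend hx hf ?_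
    rcases lt_trichotomy i j with hij | rfl | hij
    · rcases (Nat.succ_le_of_lt hij).eq_or_lt with rfl | hij'
      · exact ⟨1, one_mem _, 1, one_mem _, i, hi.le, by simp [coset]⟩
      · exact ⟨s (i + 1), memH (by omega) (by omega), 1, one_mem _, j, hj, by
          rw [h.coset_mul_of_lt hij' hj, mul_one]⟩
    · exact ⟨1, one_mem _, loop s i, memF hi, i + 1, hi, by simp [coset, loop, mul_assoc]⟩
    · exact ⟨s i, memH (by omega) hi, 1, one_mem _, j, hj, by
        rw [(h.coset_comm hij).eq, mul_one]⟩
  | mul_inv_cancel g _ y hy ih =>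
    obtain ⟨i, hi, rfl⟩ := hy
    obtain ⟨x, hx, f, hf, j, hj, rfl⟩ := ih
    refine extend hx hf ?_
    rcases lt_trichotomy i j with hij | rfl | hij
    · rcases (Nat.succ_le_of_lt hij).eq_or_lt with rfl | hij'
      · exact ⟨1, one_mem _, (loop s i)⁻¹, inv_mem (memF hi), i, hi.le, by
          simp [coset, loop, mul_assoc]⟩
      · refine ⟨(s (i + 1))⁻¹, inv_mem (memH (by omega) (by omega)), 1, one_mem _, j, hj, ?_⟩
        rw [mul_inv_eq_iff_eq_mul, mul_one, mul_assoc, h.coset_mul_of_lt hij' hj,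
          inv_mul_cancel_left]
    · exact ⟨1, one_mem _, 1, one_mem _, i + 1, hi, by simp [coset]⟩
    · exact ⟨(s i)⁻¹, inv_mem (memH (by omega) hi), 1, one_mem _, j, hj, by
        rw [(h.coset_comm hij).inv_right.eq, mul_one]⟩

end IsBraided

end Coset

/-- The Artin generators, extended by `1` beyond their range. -/
def gen (n i : ℕ) : BraidGroup n := if h : i < n - 1 then braidGen ⟨i, h⟩ else 1

theorem braidGen_comm {n : ℕ} {i j : Fin (n - 1)} (h : (i : ℕ) + 2 ≤ j) :
    Commute (braidGen i : BraidGroup n) (braidGen j) := by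
  have := PresentedGroup.one_of_mem (rels := braidRels n) ⟨i, j, .inr ⟨h, rfl⟩⟩
  exact mul_inv_eq_one.1 this

theorem braidGen_braid {n : ℕ} {i j : Fin (n - 1)} (h : (i : ℕ) + 1 = j) :
    (braidGen i * braidGen j * braidGen i : BraidGroup n) =
      braidGen j * braidGen i * braidGen j := by
  have := PresentedGroup.one_of_mem (rels := braidRels n) ⟨i, j, .inl ⟨h, rfl⟩⟩
  exact mul_inv_eq_one.1 this

theorem isBraided_gen (n k : ℕ) : IsBraided (fun i => gen n (k + i)) (n - 1 - k) where
  comm i j hij := by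
    simp only [gen]
    split_ifs
    · exact braidGen_comm (by simpa [add_assoc] using hij)
    · exact Commute.one_right _
    · exact Commute.one_left _
    · exact Commute.one_left _
  braid i hi := by
    simp only [gen]
    rw [dif_pos (by omega), dif_pos (by omega)]
    exact braidGen_braid (add_assoc _ _ _)

namespace Marking

variable {A X : Type*} [Group A] [MulAction A X] {n : ℕ}

theorem gen_smul {i : ℕ} (hi : i < n - 1) (D : Marking A X) : gen n i • D = D.twist i := by
  rw [gen, dif_pos hi, braidGen_smul]

theorem gen_inv_smul {i : ℕ} (hi : i < n - 1) (D : Marking A X) :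
    (gen n i)⁻¹ • D = D.untwist i := by
  rw [gen, dif_pos hi, braidGen_inv_smul]

theorem coset_smul {k j : ℕ} (hj : j ≤ n - 1 - k) (D : Marking A X) :
    (coset (fun i => gen n (k + i)) j • D).u k = D.u (k + j) ∧
      (coset (fun i => gen n (k + i)) j • D).p k = D.p (k + j) := by
  induction j generalizing D with
  | zero => simp [coset]
  | succ j ih =>
    rw [coset, mul_smul, (ih (by omega) _).1, (ih (by omega) _).2, gen_inv_smul (by omega)]
    simp [untwist_u, untwist_p, add_assoc]

theorem smul_p_of_mem_closure {k : ℕ} {g : BraidGroup n}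
    (hg : g ∈ Subgroup.closure (gen n '' Set.Ico (k + 1) (n - 1))) (D : Marking A X) :
    (g • D).p k = D.p k := by
  induction hg using Subgroup.closure_induction generalizing D with
  | mem g hg =>
    obtain ⟨i, ⟨h1, h2⟩, rfl⟩ := hg
    rw [gen_smul h2, twist_p, if_neg (by omega), if_neg (by omega)]
  | one => rw [one_smul]
  | mul g g' _ _ ih ih' => rw [mul_smul, ih, ih']
  | inv g _ ih => rw [← ih, smul_inv_smul]

/-- Change the `k`-th point of a marking. -/
def setP (D : Marking A X) (k : ℕ) (x : X) : Marking A X := ⟨D.u, Function.update D.p k x⟩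

theorem twist_setP {i k : ℕ} (hki : k < i) (D : Marking A X) (x : X) :
    (D.setP k x).twist i = (D.twist i).setP k x := by
  ext j
  · rfl
  · have h1 : i ≠ k := by omega
    have h2 : i + 1 ≠ k := by omega
    by_cases h : j = k
    · subst h; simp [setP, twist_p, h1.symm, h2.symm]
    · simp [setP, twist_p, h, h1, h2]

theorem loop_smul {k t : ℕ} (ht : t < n - 1 - k) (D : Marking A X) (hD : D.u k = 1) :
    loop (fun i => gen n (k + i)) t • D = D.setP k (D.u (k + t + 1) • D.p k) := by
  induction t generalizing D with
  | zero =>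
    have e : loop (fun i => gen n (k + i)) 0 = gen n k * gen n k := by simp [loop, coset]
    rw [e, mul_smul, gen_smul (by omega), gen_smul (by omega)]
    ext j <;> by_cases h : j = k <;> by_cases h' : j = k + 1 <;>
      first | omega | simp [setP, twist_u, twist_p, h, h', hD]
  | succ t ih =>
    have h1 : k < k + (t + 1) := by omega
    have h2 : k + (t + 1) < n - 1 := by omega
    rw [(isBraided_gen n k).loop_succ ht, mul_smul, mul_smul, gen_inv_smul h2, gen_smul h2, ih,
      twist_setP h1, twist_untwist]
    · simp [untwist_u, untwist_p, add_assoc]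
    · omega
    · rw [untwist_u, if_neg (by omega), if_neg (by omega), hD]

theorem lift_loop_smul {k : ℕ} {v : FreeGroup ℕ}
    (hv : v ∈ Subgroup.closure (FreeGroup.of '' Set.Iio (n - 1 - k))) (D : Marking A X)
    (hD : D.u k = 1) : FreeGroup.lift (loop fun i => gen n (k + i)) v • D =
      D.setP k (FreeGroup.lift (fun t => D.u (k + t + 1)) v • D.p k) := by
  induction hv using Subgroup.closure_induction generalizing D with
  | mem v hv =>
    obtain ⟨t, ht, rfl⟩ := hv
    simp [loop_smul ht D hD]
  | one => simp [setP]
  | mul v w _ _ ihv ihw =>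
    rw [map_mul, mul_smul, ihw D hD, ihv (D.setP k _) hD]
    simp [setP, mul_smul]
  | inv v _ ih =>
    rw [map_inv, inv_smul_eq_iff, ih (D.setP k _) hD]
    simp [setP]

end Marking

theorem mem_closure_succ {n k : ℕ} {g : BraidGroup n} (hg : ∀ i, (g • univ).p i = ⟨i, 1⟩)
    (hk : g ∈ Subgroup.closure (gen n '' Set.Ico k (n - 1))) :
    g ∈ Subgroup.closure (gen n '' Set.Ico (k + 1) (n - 1)) := by
  set s : ℕ → BraidGroup n := fun i => gen n (k + i)
  have e0 : gen n '' Set.Ico k (n - 1) = s '' Set.Iio (n - 1 - k) := by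
    ext x
    constructor
    · rintro ⟨i, ⟨h1, h2⟩, rfl⟩
      exact ⟨i - k, by simp; omega, by simp [s, h1]⟩
    · rintro ⟨i, hi, rfl⟩
      simp only [Set.mem_Iio] at hi
      exact ⟨k + i, ⟨by omega, by omega⟩, rfl⟩
  have e1 : s '' Set.Ico 1 (n - 1 - k) ⊆ gen n '' Set.Ico (k + 1) (n - 1) := by
    rintro _ ⟨i, ⟨h1, h2⟩, rfl⟩
    exact ⟨k + i, ⟨by omega, by omega⟩, rfl⟩
  rw [e0] at hk
  obtain ⟨x, hx, f, hf, j, hj, rfl⟩ := (isBraided_gen n k).exists_eq_mul_mul_coset hk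
  replace hx := Subgroup.closure_mono e1 hx
  have hf' : f ∈ (Subgroup.closure (FreeGroup.of '' Set.Iio (n - 1 - k))).map
      (FreeGroup.lift (loop s)) := by
    have e : FreeGroup.lift (loop s) ∘ FreeGroup.of = loop s := funext fun t => by simp
    rwa [MonoidHom.map_closure, ← Set.image_comp, e]
  obtain ⟨v, hv, rfl⟩ := hf'
  have key (D : Marking (FreeGroup ℕ) (Label (FreeGroup ℕ))) (hD : D.u (k + j) = 1) :
      FreeGroup.lift (fun t => (coset s j • D).u (k + t + 1)) v • D.p (k + j) = D.p k := by
    have h1 := smul_p_of_trivial (hg k) D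
    rw [mul_smul, mul_smul, smul_p_of_mem_closure hx, lift_loop_smul hv _
      ((coset_smul hj D).1.trans hD)] at h1
    simpa [setP, (coset_smul hj D).2, s] using h1
  have hj0 : j = 0 := by
    have := congrArg Sigma.fst (key ⟨fun _ => 1, univ.p⟩ rfl)
    simpa [univ, Sigma.smul_mk] using this
  subst hj0
  have hv1 : v = 1 := by
    have := congrArg Sigma.snd (key ⟨fun i => if i ≤ k then 1 else .of (i - k - 1), univ.p⟩
      (by simp))
    have e : (fun t => if k + t + 1 ≤ k then 1 else FreeGroup.of (k + t + 1 - k - 1)) =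
        FreeGroup.of := by
      ext t
      rw [if_neg (by omega)]
      congr 1
      omega
    simp only [coset, one_smul, e] at this
    simpa [univ, Sigma.smul_mk, FreeGroup.lift_of_eq_id] using this
  subst hv1
  simpa [coset] using hx

/-- The action of the braid group on the universal marking is faithful. -/
theorem eq_one_of_forall_smul_univ {n : ℕ} {g : BraidGroup n}
    (hg : ∀ i, (g • univ).p i = ⟨i, 1⟩) : g = 1 := by
  have top : Subgroup.closure (gen n '' Set.Ico 0 (n - 1)) = ⊤ := by
    rw [← closure_range_braidGen, eq_comm]
    congr 1
    ext x
    constructor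
    · rintro ⟨i, rfl⟩
      exact ⟨i, ⟨by omega, i.2⟩, by simp [gen]⟩
    · rintro ⟨i, ⟨-, hi⟩, rfl⟩
      exact ⟨⟨i, hi⟩, by simp [gen, hi]⟩
  have mem (k : ℕ) : g ∈ Subgroup.closure (gen n '' Set.Ico k (n - 1)) := by
    induction k with
    | zero => rw [top]; trivial
    | succ k ih => exact mem_closure_succ hg ih
  simpa using mem (n - 1)

section Realization

/-- A projective transformation preserving the unit interval. -/
noncomputable def mobius (α β r : ℝ) : ℝ := α * r / (β * (1 - r) + α * r)

theorem mobius_den_pos {α β r : ℝ} (hα : 0 < α) (hβ : 0 < β) (h0 : 0 ≤ r) (h1 : r < 1) :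
    0 < β * (1 - r) + α * r :=
  add_pos_of_pos_of_nonneg (mul_pos hβ (sub_pos.2 h1)) (mul_nonneg hα.le h0)

theorem mobius_mem {α β r : ℝ} (hα : 0 < α) (hβ : 0 < β) (h : r ∈ Set.Ico (0 : ℝ) 1) :
    mobius α β r ∈ Set.Ico (0 : ℝ) 1 := by
  have hd := mobius_den_pos hα hβ h.1 h.2
  refine ⟨div_nonneg (mul_nonneg hα.le h.1) hd.le, (div_lt_one hd).2 ?_⟩
  linarith [mul_pos hβ (sub_pos.2 h.2)]

theorem mobius_lt {α β r s : ℝ} (hα : 0 < α) (hβ : 0 < β) (hr : 0 ≤ r) (hrs : r < s)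
    (hs : s < 1) : mobius α β r < mobius α β s := by
  rw [mobius, mobius, div_lt_div_iff₀ (mobius_den_pos hα hβ hr (hrs.trans hs))
    (mobius_den_pos hα hβ (hr.trans hrs.le) hs)]
  nlinarith [mul_pos (mul_pos hα hβ) (sub_pos.2 hrs)]

theorem mobius_mobius {α β r : ℝ} (hα : 0 < α) (hβ : 0 < β) (h : r ∈ Set.Ico (0 : ℝ) 1) :
    mobius α β (mobius β α r) = r := by
  have hd := mobius_den_pos hβ hα h.1 h.2
  have hd' := mobius_den_pos hα hβ (mobius_mem hβ hα h).1 (mobius_mem hβ hα h).2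
  rw [mobius, div_eq_iff hd'.ne', mobius]
  field_simp
  ring

/-- The extension of `mobius` commuting with integer translations. -/
noncomputable def periodicMobius (α β t : ℝ) : ℝ := ⌊t⌋ + mobius α β (Int.fract t)

theorem fract_mem (t : ℝ) : Int.fract t ∈ Set.Ico (0 : ℝ) 1 :=
  ⟨Int.fract_nonneg t, Int.fract_lt_one t⟩

theorem periodicMobius_strictMono {α β : ℝ} (hα : 0 < α) (hβ : 0 < β) :
    StrictMono (periodicMobius α β) := by
  intro s t hst
  have hs := mobius_mem hα hβ (fract_mem s)
  have ht := mobius_mem hα hβ (fract_mem t)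
  rw [periodicMobius, periodicMobius]
  rcases (Int.floor_mono hst.le).eq_or_lt with h | h
  · rw [h, add_lt_add_iff_left]
    refine mobius_lt hα hβ (Int.fract_nonneg s) ?_ (Int.fract_lt_one t)
    rw [Int.fract, Int.fract, h]
    exact sub_lt_sub_right hst _
  · have : (⌊s⌋ : ℝ) + 1 ≤ ⌊t⌋ := by exact_mod_cast h
    linarith [hs.2, ht.1]

theorem periodicMobius_periodicMobius {α β : ℝ} (hα : 0 < α) (hβ : 0 < β) (t : ℝ) :
    periodicMobius α β (periodicMobius β α t) = t := by
  have h := mobius_mem hβ hα (fract_mem t)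
  rw [periodicMobius, periodicMobius, Int.floor_intCast_add, Int.fract_intCast_add,
    Int.floor_eq_zero_iff.2 h, Int.fract_eq_self.2 h, mobius_mobius hα hβ (fract_mem t),
    add_zero, Int.floor_add_fract]

theorem exists_orderIso {p a b : ℝ} (ha : p < a) (ha' : a < p + 1) (hb : p < b)
    (hb' : b < p + 1) :
    ∃ u : ℝ ≃o ℝ, (∀ x, u (x + 1) = u x + 1) ∧ u p = p - 1 ∧ u a = b - 1 := by
  set α := (b - p) * (p + 1 - a)
  set β := (a - p) * (p + 1 - b)
  have hα : 0 < α := mul_pos (by linarith) (by linarith)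
  have hβ : 0 < β := mul_pos (by linarith) (by linarith)
  refine ⟨(OrderIso.addRight (-p)).trans (((periodicMobius_strictMono hα
    hβ).orderIsoOfRightInverse _ _ (periodicMobius_periodicMobius hα hβ)).trans
    (OrderIso.addRight (p - 1))), fun x => ?_, ?_, ?_⟩
  · change periodicMobius α β (x + 1 + -p) + (p - 1) = periodicMobius α β (x + -p) + (p - 1) + 1
    rw [add_right_comm, periodicMobius, Int.floor_add_one, Int.fract_add_one, periodicMobius]
    push_cast
    ring
  · change periodicMobius α β (p + -p) + (p - 1) = p - 1
    simp [periodicMobius, mobius]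
  · change periodicMobius α β (a + -p) + (p - 1) = b - 1
    have h : a + -p ∈ Set.Ico (0 : ℝ) 1 := ⟨by linarith, by linarith⟩
    have hd := mobius_den_pos hα hβ h.1 h.2
    rw [periodicMobius, Int.floor_eq_zero_iff.2 h, Int.fract_eq_self.2 h, mobius]
    have : α * (a + -p) / (β * (1 - (a + -p)) + α * (a + -p)) = b - p := by
      rw [div_eq_iff hd.ne']
      simp only [α, β]
      ring
    rw [this]
    push_cast
    ring

theorem exists_isConfig : ∃ (z : ℝ ≃o ℝ) (D : Marking (ℝ ≃o ℝ) ℝ) (q : ℕ → ℝ), IsConfig z D q := by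
  set φ : ℝ → ℝ := fun x => -(1 / (x + 1))
  have hφ {x y : ℝ} (hx : 0 ≤ x) (hxy : x < y) : φ x < φ y :=
    neg_lt_neg (one_div_lt_one_div_of_lt (by linarith) (by linarith))
  have hφ0 {x : ℝ} (hx : 0 ≤ x) : φ x < φ 0 + 1 := by
    have : 0 < 1 / (x + 1) := one_div_pos.2 (by linarith)
    simp only [φ]
    norm_num at *
    linarith
  have hφ' {x : ℝ} (hx : 0 ≤ x) : φ 0 ≤ φ x := by
    rcases hx.eq_or_lt with rfl | h
    · exact le_rfl
    · exact (hφ le_rfl h).le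
  have hφ1 {x y : ℝ} (hx : 0 ≤ x) (hy : 0 ≤ y) : φ x < φ y + 1 := by
    linarith [hφ0 hx, hφ' hy]
  have hi (i : ℕ) : (0 : ℝ) ≤ i := i.cast_nonneg
  have hi' (i : ℕ) : (0 : ℝ) ≤ i + 1 / 2 := by linarith [hi i]
  have hq (i : ℕ) : φ i < φ (i + 1 / 2) := hφ (hi i) (by linarith)
  have hp (i : ℕ) : φ (i + 1 / 2) < φ (i + 1 : ℕ) :=
    hφ (hi' i) (by push_cast; linarith)
  choose u hu1 hup huq using fun i : ℕ => exists_orderIso (p := φ (i + 1 / 2)) (a := φ (i + 1 : ℕ))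
    (b := φ i + 1) (hp i) (hφ1 (hi (i + 1)) (hi' i)) (hφ1 (hi' i) (hi i)) (by linarith [hq i])
  refine ⟨OrderIso.addRight 1, ⟨u, fun i => φ (i + 1 / 2)⟩, fun i => φ i, fun a => a.strictMono,
    fun i => ?_, hq, hp, fun i => ?_, fun i => ?_, fun i => ?_⟩
  · ext x
    exact (hu1 i x).symm
  · simpa using hφ0 (hi i)
  · rw [eq_inv_smul_iff]
    change u i _ + 1 = _
    rw [hup, sub_add_cancel]
  · exact (huq i).trans (add_sub_cancel_right _ _)

end Realization

section Order

variable {n : ℕ}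

/-- A braid is positive if it moves the first marked point that it moves to the left. -/
def Pos (g : BraidGroup n) : Prop :=
  ∃ i, (∀ j < i, (g • univ).p j = ⟨j, 1⟩) ∧ Below ((g • univ).p i) i

namespace IsConfig

variable {A L : Type} [Group A] [LinearOrder L] [MulAction A L] {z : A} {D : Marking A L}
  {q : ℕ → L}

theorem smul_p_lt (h : IsConfig z D q) {g : BraidGroup n} {i : ℕ} (hg : Below ((g • univ).p i) i) :
    (g • D).p i < D.p i := by
  rw [smul_p]
  exact hg A L z D q h

theorem smul_univ_p_of_eq (h : IsConfig z D q) {g : BraidGroup n} {i : ℕ}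
    (hg : (g • D).p i = D.p i) : (g • univ).p i = ⟨i, 1⟩ := by
  rw [smul_p] at hg
  rcases eq_or_below_or_above ((g • univ).p i) i with hl | hl | hl
  · exact hl
  · exact absurd hg (hl A L z D q h).ne
  · exact absurd hg (hl A L z D q h).ne'

theorem below_of_smul_p_lt (h : IsConfig z D q) {g : BraidGroup n} {i : ℕ}
    (hg : (g • D).p i < D.p i) : Below ((g • univ).p i) i := by
  rw [smul_p] at hg
  rcases eq_or_below_or_above ((g • univ).p i) i with hl | hl | hl
  · rw [hl] at hg
    simp [Marking.eval] at hg
  · exact hl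
  · exact absurd hg (hl A L z D q h).not_gt

end IsConfig

theorem Pos.mul {g g' : BraidGroup n} (hg : Pos g) (hg' : Pos g') : Pos (g * g') := by
  obtain ⟨z, D, q, h⟩ := exists_isConfig
  obtain ⟨i, hi, hgi⟩ := hg
  obtain ⟨j, hj, hgj⟩ := hg'
  obtain ⟨q', h'⟩ := h.exists_smul g'
  refine ⟨min i j, fun k hk => h.smul_univ_p_of_eq ?_, h.below_of_smul_p_lt ?_⟩
  · rw [mul_smul, smul_p_of_trivial (hi k (lt_min_iff.1 hk).1),
      smul_p_of_trivial (hj k (lt_min_iff.1 hk).2)]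
  · rw [mul_smul]
    rcases lt_trichotomy i j with hij | rfl | hij
    · rw [min_eq_left hij.le, ← smul_p_of_trivial (hj i hij) D]
      exact h'.smul_p_lt hgi
    · rw [min_self]
      exact (h'.smul_p_lt hgi).trans (h.smul_p_lt hgj)
    · rw [min_eq_right hij.le, smul_p_of_trivial (hi j hij)]
      exact h.smul_p_lt hgj

theorem not_pos_one : ¬ Pos (1 : BraidGroup n) := by
  rintro ⟨i, -, hi⟩
  obtain ⟨z, D, q, h⟩ := exists_isConfig
  exact (h.smul_p_lt hi).ne (by rw [one_smul])

theorem pos_or_pos_inv {g : BraidGroup n} (hg : g ≠ 1) : Pos g ∨ Pos g⁻¹ := by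
  obtain ⟨z, D, q, h⟩ := exists_isConfig
  have hex : ∃ i, (g • univ).p i ≠ ⟨i, 1⟩ := by
    by_contra! hc
    exact hg (eq_one_of_forall_smul_univ hc)
  classical
  have hmin : ∀ j < Nat.find hex, (g • univ).p j = ⟨j, 1⟩ := fun j hj =>
    not_not.1 (Nat.find_min hex hj)
  obtain ⟨q', h'⟩ := h.exists_smul g⁻¹
  rcases eq_or_below_or_above ((g • univ).p (Nat.find hex)) (Nat.find hex) with hl | hl | hl
  · exact absurd hl (Nat.find_spec hex)
  · exact .inl ⟨_, hmin, hl⟩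
  · refine .inr ⟨Nat.find hex, fun j hj => h.smul_univ_p_of_eq ?_, h.below_of_smul_p_lt ?_⟩
    · rw [← smul_p_of_trivial (hmin j hj) (g⁻¹ • D), smul_inv_smul]
    · have := hl _ _ z (g⁻¹ • D) q' h'
      rwa [← smul_p, smul_inv_smul] at this

theorem pos_rev {rev : BraidGroup n → BraidGroup n} (hmul : ∀ x y, rev (x * y) = rev y * rev x)
    (hgen : ∀ i, rev (braidGen i) = braidGen i) {g : BraidGroup n} (hg : Pos g) : Pos (rev g) := by
  obtain ⟨z, D, q, h⟩ := exists_isConfig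
  obtain ⟨i, hi, hgi⟩ := hg
  obtain ⟨q', h'⟩ := h.exists_smul g
  have hE := h'.mirror
  have hrev : rev g • (g • D).mirror.map id OrderDual.toDual =
      D.mirror.map id OrderDual.toDual := by
    rw [← rev_smul_mirror hmul hgen g D]
    exact (map_smul (MonoidHom.id _) OrderDual.toDual (fun _ _ => rfl) (rev g)
      (g • D).mirror).symm
  have hpre (j : ℕ) (hj : j ≤ i) : (g • D).prefixProd j = D.prefixProd j :=
    prefixProd_congr fun k hk => smul_u_of_trivial (hi k (by omega)) D
  refine ⟨i, fun j hj => hE.smul_univ_p_of_eq ?_, hE.below_of_smul_p_lt ?_⟩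
  · rw [hrev]
    change D.prefixProd j • D.p j = (g • D).prefixProd j • (g • D).p j
    rw [hpre j hj.le, smul_p_of_trivial (hi j hj)]
  · rw [hrev]
    change (g • D).prefixProd i • (g • D).p i < D.prefixProd i • D.p i
    rw [hpre i le_rfl, h.smul_lt]
    exact h.smul_p_lt hgi

/-- The left-invariant order with positive cone `Pos`. -/
@[reducible] noncomputable def braidOrder (n : ℕ) : LinearOrder (BraidGroup n) := by
  classical
  exact
  { le := fun x y => x = y ∨ Pos (x⁻¹ * y)
    lt := fun x y => Pos (x⁻¹ * y)
    le_refl := fun x => .inl rfl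
    le_trans := by
      rintro x y w (rfl | hxy) (rfl | hyw)
      · exact .inl rfl
      · exact .inr hyw
      · exact .inr hxy
      · right
        simpa [mul_assoc] using hxy.mul hyw
    le_antisymm := by
      rintro x y (rfl | hxy) (h | hyx)
      · rfl
      · rfl
      · exact h.symm
      · refine absurd (hxy.mul hyx) ?_
        simpa [mul_assoc] using not_pos_one
    lt_iff_le_not_ge := by
      intro x y
      constructor
      · refine fun hxy => ⟨.inr hxy, ?_⟩
        rintro (rfl | hyx)
        · exact not_pos_one (by simpa using hxy)
        · exact not_pos_one (by simpa [mul_assoc] using hxy.mul hyx)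
      · rintro ⟨rfl | hxy, hyx⟩
        · exact absurd (.inl rfl) hyx
        · exact hxy
    le_total := by
      intro x y
      by_cases hxy : x⁻¹ * y = 1
      · exact .inl (.inl (inv_mul_eq_one.1 hxy))
      · rcases pos_or_pos_inv hxy with h | h
        · exact .inl (.inr h)
        · exact .inr (.inr (by simpa using h))
    toDecidableLE := Classical.decRel _ }

end Order

end BraidOrder

/-- For every `n ≥ 2`, the braid group `B n` admits a left-invariant linear
order `<` such that `x > 1` iff `rev x > 1`, where `rev` is the (unique) involutive
anti-automorphism of `B n` fixing each generator `σ i`. -/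
theorem braidGroup_exists_leftInvariant_order_compatible_with_rev
    (n : ℕ) (hn : 2 ≤ n)
    (rev : BraidGroup n → BraidGroup n)
    (hmul : ∀ x y, rev (x * y) = rev y * rev x)
    (hinv : ∀ x, rev (rev x) = x)
    (hgen : ∀ i : Fin (n - 1), rev (braidGen i) = braidGen i) :
    ∃ lo : LinearOrder (BraidGroup n),
      (∀ a x y : BraidGroup n, lo.lt x y → lo.lt (a * x) (a * y)) ∧
      (∀ x : BraidGroup n, lo.lt 1 x ↔ lo.lt 1 (rev x)) := by
  have hpos (x y : BraidGroup n) :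
      (BraidOrder.braidOrder n).lt x y ↔ BraidOrder.Pos (x⁻¹ * y) := Iff.rfl
  refine ⟨BraidOrder.braidOrder n, fun a x y hxy => ?_, fun x => ?_⟩
  · rw [hpos] at hxy ⊢
    simpa [mul_assoc] using hxy
  · rw [hpos, hpos, inv_one, one_mul, one_mul]
    refine ⟨BraidOrder.pos_rev hmul hgen, fun h => ?_⟩
    simpa only [hinv] using BraidOrder.pos_rev hmul hgen h
end
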